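/- arXiv:2210.11110 — 4 statements merged into one kernel-verified Lean document; each statement's English description precedes it below -/
import Mathlib

section
/- Let f be a non wandering positive twist map of the closed annulus A = 𝕋 × [0,1] such that no essential simple loop meeting each vertical segment {x}×[0,1] in exactly one point is f-invariant, except C₀ and C₁. Let X₀ ⊆ A be a continuum with X₀ ⊆ f(X₀), strictly containing C₀ and disjoint from C₁, and let X₁ ⊆ A be a continuum with f(X₁) ⊆ X₁, strictly containing C₁ and disjoint from C₀. Then there exists n ≥ 0 such that fⁿ(X₀) ∩ X₁ ≠ ∅, and every point z ∈ fⁿ(X₀) ∩ X₁ satisfies lim_{k→−∞} d(fᵏ(z), C₀) = lim_{k→+∞} d(fᵏ(z), C₁) = 0. -/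
open Set Filter Topology MeasureTheory

noncomputable section

/-- The circle `𝕋 = ℝ/ℤ`. -/
abbrev 𝕋 : Type := AddCircle (1 : ℝ)

/-- The closed annulus `A = 𝕋 × [0,1]`. -/
abbrev Ann : Type := 𝕋 × ↥(Set.Icc (0:ℝ) 1)

/-- The universal cover `Ã = ℝ × [0,1]`. -/
abbrev StripA : Type := ℝ × ↥(Set.Icc (0:ℝ) 1)

/-- The covering projection `π : Ã → A`. -/
def annProj : StripA → Ann := fun z => ((z.1 : 𝕋), z.2)

/-- The deck translation `T(x̃,y) = (x̃+1,y)`. -/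
def deckT : StripA → StripA := fun z => (z.1 + 1, z.2)

/-- The iterated deck translation `T^p`, `p ∈ ℤ`. -/
def deckZ (p : ℤ) : StripA → StripA := fun z => (z.1 + (p : ℝ), z.2)

/-- The boundary circle `C₀ = 𝕋 × {0}`. -/
def C0 : Set Ann := {z | (z.2 : ℝ) = 0}

/-- The boundary circle `C₁ = 𝕋 × {1}`. -/
def C1 : Set Ann := {z | (z.2 : ℝ) = 1}

/-- A point of `Ã` on the boundary line `ℝ × {0}`. -/
def bd0 (x : ℝ) : StripA := (x, ⟨0, by norm_num⟩)

/-- A point of `Ã` on the boundary line `ℝ × {1}`. -/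
def bd1 (x : ℝ) : StripA := (x, ⟨1, by norm_num⟩)

/-- A homeomorphism of the closed annulus isotopic to the identity, together with a
chosen lift to the universal cover.  (A homeomorphism of `A` is isotopic to the identity
iff it admits a lift commuting with the deck translation and preserving each boundary
line of the strip.) -/
structure AnnulusHomeo where
  toFun : Ann ≃ₜ Ann
  lift : StripA ≃ₜ StripA
  lift_proj : ∀ z : StripA, annProj (lift z) = toFun (annProj z)
  lift_deck : ∀ z : StripA, lift (deckT z) = deckT (lift z)
  lift_bd0 : ∀ z : StripA, (z.2 : ℝ) = 0 → ((lift z).2 : ℝ) = 0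

/-- The iterate `f^k`, `k ∈ ℤ`. -/
def AnnulusHomeo.iter (h : AnnulusHomeo) (k : ℤ) : Ann → Ann :=
  fun z => ((h.toFun.toEquiv : Equiv.Perm Ann) ^ k) z

/-- The iterate `f̃^k` of the lift, `k ∈ ℤ`. -/
def AnnulusHomeo.liftIter (h : AnnulusHomeo) (k : ℤ) : StripA → StripA :=
  fun z => ((h.lift.toEquiv : Equiv.Perm StripA) ^ k) z

/-- `f` is non wandering: every nonempty open set meets one of its forward iterates. -/
def NonWandering (h : AnnulusHomeo) : Prop :=
  ∀ U : Set Ann, IsOpen U → U.Nonempty → ∃ k : ℕ, 0 < k ∧ (h.iter k '' U ∩ U).Nonempty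

/-- The closed strip `ℝ × [0,1]` inside the plane. -/
def stripS : Set (ℝ × ℝ) := {p | p.2 ∈ Set.Icc (0:ℝ) 1}

/-- A positive twist map: a `C¹` diffeomorphism of the annulus, isotopic to the identity,
whose lift `F` to the strip (together with its inverse `G`) is continuously differentiable
and satisfies `∂(p̃₁ ∘ f̃)/∂y > 0`, i.e. the first component of `DF(z)·(0,1)` is positive. -/
structure PositiveTwistMap extends AnnulusHomeo where
  F : ℝ × ℝ → ℝ × ℝ
  F' : ℝ × ℝ → (ℝ × ℝ) →L[ℝ] (ℝ × ℝ)
  G : ℝ × ℝ → ℝ × ℝ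
  G' : ℝ × ℝ → (ℝ × ℝ) →L[ℝ] (ℝ × ℝ)
  F_lift : ∀ z : StripA, F (z.1, (z.2 : ℝ)) = ((lift z).1, ((lift z).2 : ℝ))
  G_lift : ∀ z : StripA, G (z.1, (z.2 : ℝ)) = ((lift.symm z).1, ((lift.symm z).2 : ℝ))
  F_hasDeriv : ∀ z ∈ stripS, HasFDerivWithinAt F (F' z) stripS z
  G_hasDeriv : ∀ z ∈ stripS, HasFDerivWithinAt G (G' z) stripS z
  F'_cont : ContinuousOn F' stripS
  G'_cont : ContinuousOn G' stripS
  twist_pos : ∀ z ∈ stripS, 0 < (F' z (0, 1)).1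

/-- The oriented angle (in `(-π, π]`) from the vertical vector `(0,1)` to the vector `w`. -/
def angleFromVertical (w : ℝ × ℝ) : ℝ := Complex.arg ⟨w.2, -w.1⟩

/-- `ρ` is the rotation number of `f` on the boundary circle `C₀`, computed with the lift. -/
def HasRotNum0 (h : AnnulusHomeo) (ρ : ℝ) : Prop :=
  ∀ x : ℝ, Tendsto (fun n : ℕ => ((h.liftIter (n : ℤ) (bd0 x)).1 - x) / (n : ℝ))
    atTop (𝓝 ρ)

/-- `ρ` is the rotation number of `f` on the boundary circle `C₁`, computed with the lift. -/
def HasRotNum1 (h : AnnulusHomeo) (ρ : ℝ) : Prop :=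
  ∀ x : ℝ, Tendsto (fun n : ℕ => ((h.liftIter (n : ℤ) (bd1 x)).1 - x) / (n : ℝ))
    atTop (𝓝 ρ)

/-- A closed `f`-invariant set `X ⊆ A` is well ordered if the first projection is injective
on `X` and the lift preserves the horizontal order on `π⁻¹(X)`. -/
def IsWellOrdered (h : AnnulusHomeo) (X : Set Ann) : Prop :=
  IsClosed X ∧ h.toFun '' X = X ∧
  Set.InjOn (fun z : Ann => z.1) X ∧
  ∀ z₁ z₂ : StripA, annProj z₁ ∈ X → annProj z₂ ∈ X → z₁.1 < z₂.1 →
    (h.lift z₁).1 < (h.lift z₂).1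

/-- An essential simple loop in the annulus: the range of an injective continuous map
from the circle that is not null-homotopic. -/
def IsEssentialSimpleLoop (Γ : Set Ann) : Prop :=
  ∃ γ : C(𝕋, Ann), Function.Injective γ ∧ ¬ γ.Nullhomotopic ∧ Set.range γ = Γ

/-- `Γ` meets each vertical segment `{x} × [0,1]` in exactly one point. -/
def MeetsVerticalsOnce (Γ : Set Ann) : Prop :=
  ∀ x : 𝕋, ∃! z : Ann, z ∈ Γ ∧ z.1 = x

/-- No essential simple loop meeting each vertical segment exactly once is invariant,
except the two boundary circles. -/
def NoInvariantTransverseLoop (h : AnnulusHomeo) : Prop :=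
  ∀ Γ : Set Ann, IsEssentialSimpleLoop Γ → MeetsVerticalsOnce Γ →
    h.toFun '' Γ = Γ → Γ = C0 ∨ Γ = C1

/-- A continuum: a nonempty compact connected set. -/
def IsContinuum (X : Set Ann) : Prop := X.Nonempty ∧ IsCompact X ∧ IsPreconnected X

/-- A lower annulus: an open set homeomorphic to `𝕋 × [0,1)` containing `C₀`. -/
def IsLowerAnnulus (U : Set Ann) : Prop :=
  IsOpen U ∧ Nonempty (↥U ≃ₜ (𝕋 × ↥(Set.Ico (0:ℝ) 1))) ∧ C0 ⊆ U

/-- A lower disk: an open set homeomorphic to `ℝ × [0,1)` meeting `C₀`. -/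
def IsLowerDisk (U : Set Ann) : Prop :=
  IsOpen U ∧ Nonempty (↥U ≃ₜ (ℝ × ↥(Set.Ico (0:ℝ) 1))) ∧ (U ∩ C0).Nonempty

/-- A lower annulus is regular if it is a connected component of the complement of an
essential simple loop. -/
def IsRegularLowerAnnulus (U : Set Ann) : Prop :=
  ∃ Γ : Set Ann, IsEssentialSimpleLoop Γ ∧ ∃ z : Ann, U = connectedComponentIn Γᶜ z

/-- A lower disk is regular if it is a connected component of the complement of a simple
arc joining two points of `C₀` and meeting `C₀` only at its endpoints, or of the
complement of an essential simple loop meeting `C₀` in exactly one point. -/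
def IsRegularLowerDisk (U : Set Ann) : Prop :=
  (∃ a : C(↥(Set.Icc (0:ℝ) 1), Ann), Function.Injective a ∧
      (∀ t : ↥(Set.Icc (0:ℝ) 1), a t ∈ C0 ↔ ((t : ℝ) = 0 ∨ (t : ℝ) = 1)) ∧
      ∃ z : Ann, U = connectedComponentIn (Set.range a)ᶜ z) ∨
  (∃ Γ : Set Ann, IsEssentialSimpleLoop Γ ∧ (∃! z : Ann, z ∈ Γ ∩ C0) ∧
      ∃ z : Ann, U = connectedComponentIn Γᶜ z)

end

/-! ### Continuous determinations of the argument -/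

/-- `α` is a determination of the argument of `V`. -/
def IsArgLift {X : Type*} (V : X → ℂ) (α : X → ℝ) : Prop :=
  ∀ x, (α x : Real.Angle) = ((V x).arg : Real.Angle)

lemma re_im_of_coe_eq_arg {v : ℂ} {θ : ℝ} (h : (θ : Real.Angle) = (v.arg : Real.Angle)) :
    v.re = ‖v‖ * Real.cos θ ∧ v.im = ‖v‖ * Real.sin θ := by
  have h1 : Real.cos θ = Real.cos v.arg := by
    rw [← Real.Angle.cos_coe, h, Real.Angle.cos_coe]
  have h2 : Real.sin θ = Real.sin v.arg := by
    rw [← Real.Angle.sin_coe, h, Real.Angle.sin_coe]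
  rw [h1, h2]
  exact ⟨(Complex.norm_mul_cos_arg v).symm, (Complex.norm_mul_sin_arg v).symm⟩

lemma continuous_coe_arg {X : Type*} [TopologicalSpace X] {V : X → ℂ} (hV : Continuous V)
    (h0 : ∀ x, V x ≠ 0) : Continuous fun x => ((V x).arg : Real.Angle) :=
  continuous_iff_continuousAt.2 fun x =>
    ContinuousAt.comp (f := V) (Complex.continuousAt_arg_coe_angle (h0 x)) hV.continuousAt

lemma exists_argLift_unitInterval {V : unitInterval → ℂ} (hV : Continuous V)
    (h0 : ∀ x, V x ≠ 0) {θ : ℝ} (hθ : (θ : Real.Angle) = ((V 0).arg : Real.Angle)) :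
    ∃ α : unitInterval → ℝ, Continuous α ∧ IsArgLift V α ∧ α 0 = θ := by
  have cov := AddCircle.isCoveringMap_coe (2 * Real.pi)
  let g : C(unitInterval, AddCircle (2 * Real.pi)) :=
    ⟨fun x => ((V x).arg : Real.Angle), continuous_coe_arg hV h0⟩
  have hg : g 0 = QuotientAddGroup.mk θ := hθ.symm
  refine ⟨cov.liftPath g θ hg, (cov.liftPath g θ hg).continuous, ?_, cov.liftPath_zero g θ hg⟩
  intro x
  exact congrFun (cov.liftPath_lifts g θ hg) x

lemma exists_argLift_square {V : unitInterval × unitInterval → ℂ} (hV : Continuous V)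
    (h0 : ∀ x, V x ≠ 0) {α₀ : unitInterval → ℝ} (hα₀ : Continuous α₀)
    (hl : IsArgLift (fun t => V (0, t)) α₀) :
    ∃ α : unitInterval × unitInterval → ℝ, Continuous α ∧ IsArgLift V α ∧
      ∀ t, α (0, t) = α₀ t := by
  have cov := AddCircle.isCoveringMap_coe (2 * Real.pi)
  let g : C(unitInterval × unitInterval, AddCircle (2 * Real.pi)) :=
    ⟨fun x => ((V x).arg : Real.Angle), continuous_coe_arg hV h0⟩
  have hg : ∀ t, g (0, t) = QuotientAddGroup.mk (α₀ t) := fun t => (hl t).symm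
  refine ⟨cov.liftHomotopy g ⟨α₀, hα₀⟩ hg, (cov.liftHomotopy g ⟨α₀, hα₀⟩ hg).continuous, ?_,
    fun t => cov.liftHomotopy_zero g ⟨α₀, hα₀⟩ hg t⟩
  intro x
  exact congrFun (cov.liftHomotopy_lifts g ⟨α₀, hα₀⟩ hg) x

lemma IsArgLift.eq_of_eq_at {X : Type*} [TopologicalSpace X] [PreconnectedSpace X]
    {V : X → ℂ} {α β : X → ℝ} (hα : Continuous α) (hβ : Continuous β) (lα : IsArgLift V α)
    (lβ : IsArgLift V β) {x₀ : X} (h : α x₀ = β x₀) (x : X) : α x = β x := by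
  have cov := AddCircle.isCoveringMap_coe (2 * Real.pi)
  exact congrFun (cov.eq_of_comp_eq hα hβ
    (funext fun y => (lα y).trans (lβ y).symm) x₀ h) x

lemma IsArgLift.mem_Icc_of_im_nonneg {X : Type*} [TopologicalSpace X] [PreconnectedSpace X]
    {V : X → ℂ} {α : X → ℝ} (hα : Continuous α) (lα : IsArgLift V α)
    (h0 : ∀ x, V x ≠ 0) (him : ∀ x, 0 ≤ (V x).im) {x₀ : X} (h : α x₀ ∈ Icc 0 Real.pi) (x : X) :
    α x ∈ Icc 0 Real.pi := by
  have hsin : ∀ x, 0 ≤ Real.sin (α x) := by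
    intro x
    have h1 := (re_im_of_coe_eq_arg (lα x)).2
    have h2 : 0 < ‖V x‖ := norm_pos_iff.2 (h0 x)
    have h3 := him x
    rw [h1] at h3
    exact nonneg_of_mul_nonneg_right h3 h2
  have hpre : (range α).OrdConnected := (isPreconnected_range hα).ordConnected
  have hpi := Real.pi_pos
  constructor
  · by_contra hx
    push Not at hx
    have hm : max (α x) (-Real.pi / 2) ∈ range α :=
      hpre.out (mem_range_self x) (mem_range_self x₀)
        ⟨le_max_left _ _, max_le (by linarith [h.1]) (by linarith [h.1])⟩
    obtain ⟨y, hy⟩ := hm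
    have := hsin y
    rw [hy] at this
    have h4 : Real.sin (max (α x) (-Real.pi / 2)) < 0 :=
      Real.sin_neg_of_neg_of_neg_pi_lt (max_lt hx (by linarith))
        (lt_of_lt_of_le (by linarith) (le_max_right _ _))
    linarith
  · by_contra hx
    push Not at hx
    have hm : min (α x) (3 * Real.pi / 2) ∈ range α :=
      hpre.out (mem_range_self x₀) (mem_range_self x)
        ⟨le_min (by linarith [h.2]) (by linarith [h.2]), min_le_left _ _⟩
    obtain ⟨y, hy⟩ := hm
    have := hsin y
    rw [hy] at this
    have h4 : Real.sin (min (α x) (3 * Real.pi / 2) - 2 * Real.pi) < 0 := by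
      refine Real.sin_neg_of_neg_of_neg_pi_lt ?_ ?_
      · have := min_le_right (α x) (3 * Real.pi / 2); linarith
      · have : Real.pi < min (α x) (3 * Real.pi / 2) := lt_min hx (by linarith)
        linarith
    rw [Real.sin_sub_two_pi] at h4
    linarith

lemma eq_of_coe_angle_eq_of_mem_Icc {a b : ℝ} (h : (a : Real.Angle) = (b : Real.Angle))
    (ha : a ∈ Icc 0 Real.pi) (hb : b ∈ Icc 0 Real.pi) : a = b := by
  obtain ⟨k, hk⟩ := Real.Angle.angle_eq_iff_two_pi_dvd_sub.1 h
  have hpi := Real.pi_pos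
  have h1 : (k : ℝ) < 1 := by
    by_contra! hk1
    nlinarith [ha.1, ha.2, hb.1, hb.2]
  have h2 : (-1 : ℝ) < k := by
    by_contra! hk1
    nlinarith [ha.1, ha.2, hb.1, hb.2]
  have h3 : k = 0 := by
    have : k < 1 := by exact_mod_cast h1
    have : -1 < k := by exact_mod_cast h2
    omega
  rw [h3] at hk
  simp at hk
  linarith

lemma exists_mem_Icc_coe_eq_arg {v : ℂ} (h : 0 ≤ v.im) :
    ∃ θ ∈ Icc 0 Real.pi, (θ : Real.Angle) = (v.arg : Real.Angle) :=
  ⟨v.arg, ⟨Complex.arg_nonneg_iff.2 h, Complex.arg_le_pi v⟩, rfl⟩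

/-- Transport of determinations of the argument across a square whose bottom edge stays in the
upper half plane. -/
lemma argLift_square {V : unitInterval × unitInterval → ℂ} (hV : Continuous V)
    (h0 : ∀ x, V x ≠ 0) (him : ∀ s, 0 ≤ (V (s, 0)).im) {α₀ α₁ ε : unitInterval → ℝ}
    (hα₀ : Continuous α₀) (lα₀ : IsArgLift (fun t => V (0, t)) α₀) (iα₀ : α₀ 0 ∈ Icc 0 Real.pi)
    (hα₁ : Continuous α₁) (lα₁ : IsArgLift (fun t => V (1, t)) α₁) (iα₁ : α₁ 0 ∈ Icc 0 Real.pi)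
    (hε : Continuous ε) (lε : IsArgLift (fun s => V (s, 1)) ε) (h : ε 0 = α₀ 1) :
    α₁ 1 = ε 1 := by
  obtain ⟨α, hα, lα, hα0⟩ := exists_argLift_square hV h0 hα₀ lα₀
  have hb : ∀ s, α (s, 0) ∈ Icc 0 Real.pi :=
    IsArgLift.mem_Icc_of_im_nonneg (V := fun s => V (s, 0)) (α := fun s => α (s, 0))
      (by fun_prop) (fun s => lα _) (fun s => h0 _) him (x₀ := 0) (by simpa [hα0] using iα₀)
  have h10 : α (1, 0) = α₁ 0 :=
    eq_of_coe_angle_eq_of_mem_Icc ((lα _).trans (lα₁ 0).symm) (hb 1) iα₁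
  have h11 : α (1, 1) = α₁ 1 :=
    IsArgLift.eq_of_eq_at (V := fun t => V (1, t)) (α := fun t => α (1, t)) (by fun_prop) hα₁
      (fun t => lα _) lα₁ h10 1
  have h12 : α (1, 1) = ε 1 :=
    IsArgLift.eq_of_eq_at (V := fun t => V (t, 1)) (α := fun t => α (t, 1)) (by fun_prop) hε
      (fun t => lα _) lε ((hα0 1).trans h.symm) 1
  rw [← h11, h12]

/-- The local determination of the argument near `v₀` taking the value `θ` at `v₀`. -/
noncomputable def argNear (v₀ : ℂ) (θ : ℝ) (v : ℂ) : ℝ := θ + (v / v₀).arg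

lemma argNear_self {v₀ : ℂ} (h : v₀ ≠ 0) (θ : ℝ) : argNear v₀ θ v₀ = θ := by
  simp [argNear, div_self h]

lemma argNear_coe {v₀ v : ℂ} (h : v₀ ≠ 0) (hv : v ≠ 0) {θ : ℝ}
    (hθ : (θ : Real.Angle) = (v₀.arg : Real.Angle)) :
    (argNear v₀ θ v : Real.Angle) = (v.arg : Real.Angle) := by
  rw [argNear, Real.Angle.coe_add, Complex.arg_div_coe_angle hv h, hθ]
  abel

lemma argNear_continuousAt {v₀ v : ℂ} {θ : ℝ} (hv : v / v₀ ∈ Complex.slitPlane) :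
    ContinuousAt (argNear v₀ θ) v := by
  unfold argNear
  have : ContinuousAt (fun v : ℂ => v / v₀) v := by fun_prop
  exact continuousAt_const.add (ContinuousAt.comp (f := fun v : ℂ => v / v₀)
    (Complex.continuousAt_arg hv) this)

lemma argNear_nhds {v₀ : ℂ} (h : v₀ ≠ 0) :
    ∀ᶠ v in 𝓝 v₀, v / v₀ ∈ Complex.slitPlane := by
  have : ContinuousAt (fun v : ℂ => v / v₀) v₀ := by fun_prop
  refine this.eventually (Complex.isOpen_slitPlane.mem_nhds ?_)
  simp [div_self h]

/-! ### Twist lifts of the strip -/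

/-- A subset of the strip is invariant under the deck translation. -/
def DeckInv (K : Set StripA) : Prop := ∀ z, deckT z ∈ K ↔ z ∈ K

/-- The topological content of a non wandering positive twist map without invariant graphs,
recorded on the universal cover. -/
structure TwistLift where
  F : StripA ≃ₜ StripA
  deck : ∀ z, F (deckT z) = deckT (F z)
  bot : ∀ z, (F z).2 = 0 ↔ z.2 = 0
  top : ∀ z, (F z).2 = 1 ↔ z.2 = 1
  twist : ∀ z w : StripA, z.1 = w.1 → z.2 < w.2 → (F z).1 < (F w).1
  itwist : ∀ z w : StripA, z.1 = w.1 → z.2 < w.2 → (F.symm w).1 < (F.symm z).1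
  botmono : ∀ z w : StripA, z.2 = 0 → w.2 = 0 → ((F z).1 < (F w).1 ↔ z.1 < w.1)
  topmono : ∀ z w : StripA, z.2 = 1 → w.2 = 1 → ((F z).1 < (F w).1 ↔ z.1 < w.1)
  nw : ∀ W : Set StripA, IsOpen W → W.Nonempty → DeckInv W →
    ∃ k : ℕ, 0 < k ∧ ∃ z ∈ W, F^[k] z ∈ W
  graph : ∀ a : ℝ → ↥(Icc (0:ℝ) 1), Continuous a → (∀ x, a (x + 1) = a x) →
    (∀ z : StripA, (F z).2 = a (F z).1 ↔ z.2 = a z.1) → (∀ x, a x = 0) ∨ ∀ x, a x = 1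

/-- The reflection `(x, y) ↦ (-x, y)` of the strip. -/
def reflX : StripA ≃ₜ StripA where
  toFun z := (-z.1, z.2)
  invFun z := (-z.1, z.2)
  left_inv z := by simp
  right_inv z := by simp
  continuous_toFun := by fun_prop
  continuous_invFun := by fun_prop

/-- The reflection `(x, y) ↦ (x, 1 - y)` of the strip. -/
def reflY : StripA ≃ₜ StripA where
  toFun z := (z.1, unitInterval.symm z.2)
  invFun z := (z.1, unitInterval.symm z.2)
  left_inv z := by simp
  right_inv z := by simp
  continuous_toFun := by fun_prop
  continuous_invFun := by fun_prop

@[simp] lemma reflX_apply (z : StripA) : reflX z = (-z.1, z.2) := rfl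
@[simp] lemma reflY_apply (z : StripA) : reflY z = (z.1, unitInterval.symm z.2) := rfl
@[simp] lemma reflX_symm : reflX.symm = reflX := rfl
@[simp] lemma reflY_symm : reflY.symm = reflY := rfl
lemma unitIntervalSymm_eq_iff {x y : ↥(Icc (0:ℝ) 1)} :
    unitInterval.symm x = y ↔ x = unitInterval.symm y :=
  unitInterval.symm_involutive.eq_iff

lemma reflX_reflX (z : StripA) : reflX (reflX z) = z := by simp
lemma reflY_reflY (z : StripA) : reflY (reflY z) = z := by simp

lemma deckT_injective : Function.Injective deckT := by
  intro z w h
  simp only [deckT, Prod.mk.injEq, add_left_inj] at h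
  exact Prod.ext h.1 h.2

lemma continuous_deckT : Continuous deckT := by unfold deckT; fun_prop

namespace TwistLift

variable (T : TwistLift)

lemma deck_symm (z : StripA) : T.F.symm (deckT z) = deckT (T.F.symm z) := by
  apply T.F.injective
  rw [T.deck]; simp

lemma bot_symm (z : StripA) : (T.F.symm z).2 = 0 ↔ z.2 = 0 := by
  rw [← T.bot]; simp

lemma top_symm (z : StripA) : (T.F.symm z).2 = 1 ↔ z.2 = 1 := by
  rw [← T.top]; simp

/-- The conjugate of the inverse of `F` by an involution `σ`. -/
lemma conj_iterate (σ : StripA ≃ₜ StripA) (hσ : ∀ z, σ (σ z) = z) (k : ℕ) (z : StripA) :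
    (σ.trans (T.F.symm.trans σ))^[k] (σ (T.F^[k] z)) = σ z := by
  have h : Function.Semiconj σ T.F.symm (σ.trans (T.F.symm.trans σ)) := by
    intro z
    simp [hσ]
  have h2 : Function.LeftInverse T.F.symm T.F := T.F.symm_apply_apply
  rw [← (h.iterate_right k).eq, (h2.iterate k) z]

lemma conj_nw (σ : StripA ≃ₜ StripA) (hσ : ∀ z, σ (σ z) = z)
    (hd : ∀ W, DeckInv W → DeckInv (σ ⁻¹' W)) (W : Set StripA) (hW : IsOpen W)
    (hne : W.Nonempty) (hdW : DeckInv W) :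
    ∃ k : ℕ, 0 < k ∧ ∃ z ∈ W, (σ.trans (T.F.symm.trans σ))^[k] z ∈ W := by
  obtain ⟨w, hw⟩ := hne
  obtain ⟨k, hk, z, hz, hz'⟩ := T.nw (σ ⁻¹' W) (hW.preimage σ.continuous)
    ⟨σ w, by simpa [hσ] using hw⟩ (hd W hdW)
  refine ⟨k, hk, σ (T.F^[k] z), hz', ?_⟩
  rw [conj_iterate T σ hσ]
  exact hz

end TwistLift

lemma DeckInv.reflX {W : Set StripA} (h : DeckInv W) : DeckInv (reflX ⁻¹' W) := by
  intro z
  have := h (-(z.1 + 1), z.2)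
  simp only [deckT, mem_preimage, reflX_apply] at this ⊢
  rw [← this]
  simp

lemma DeckInv.reflY {W : Set StripA} (h : DeckInv W) : DeckInv (reflY ⁻¹' W) := by
  intro z
  exact h (z.1, unitInterval.symm z.2)

/-- The twist lift `R ∘ F⁻¹ ∘ R` with `R` the horizontal reflection. -/
def TwistLift.mirrorX (T : TwistLift) : TwistLift where
  F := reflX.trans (T.F.symm.trans reflX)
  deck z := by
    have h : reflX z = deckT (reflX (deckT z)) := by simp [deckT]
    have h2 : T.F.symm (reflX z) = deckT (T.F.symm (reflX (deckT z))) := by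
      rw [← T.deck_symm, ← h]
    show reflX (T.F.symm (reflX (deckT z))) = deckT (reflX (T.F.symm (reflX z)))
    rw [h2]
    simp [deckT]
  bot z := T.bot_symm (reflX z)
  top z := T.top_symm (reflX z)
  twist z w h1 h2 := by
    have := T.itwist (reflX z) (reflX w) (by simp [h1]) h2
    exact neg_lt_neg this
  itwist z w h1 h2 := by
    have := T.twist (reflX z) (reflX w) (by simp [h1]) h2
    exact neg_lt_neg this
  botmono z w h1 h2 := by
    have := T.botmono (T.F.symm (reflX w)) (T.F.symm (reflX z)) (by rw [T.bot_symm]; exact h2)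
      (by rw [T.bot_symm]; exact h1)
    simp only [Homeomorph.apply_symm_apply] at this
    have e : (reflX w).1 < (reflX z).1 ↔ z.1 < w.1 := neg_lt_neg_iff
    rw [← e, this]
    exact neg_lt_neg_iff
  topmono z w h1 h2 := by
    have := T.topmono (T.F.symm (reflX w)) (T.F.symm (reflX z)) (by rw [T.top_symm]; exact h2)
      (by rw [T.top_symm]; exact h1)
    simp only [Homeomorph.apply_symm_apply] at this
    have e : (reflX w).1 < (reflX z).1 ↔ z.1 < w.1 := neg_lt_neg_iff
    rw [← e, this]
    exact neg_lt_neg_iff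
  nw := T.conj_nw reflX reflX_reflX fun _ h => h.reflX
  graph a ha hp hi := by
    have := T.graph (fun x => a (-x)) (by fun_prop)
      (fun x => by rw [← hp (-(x + 1))]; ring_nf) (by
        intro z
        have := hi (reflX (T.F z))
        simp only [Homeomorph.trans_apply, reflX_reflX, Homeomorph.symm_apply_apply] at this
        exact this.symm)
    rcases this with h | h
    · exact Or.inl fun x => by simpa using h (-x)
    · exact Or.inr fun x => by simpa using h (-x)

/-- The twist lift `S ∘ F⁻¹ ∘ S` with `S` the vertical reflection. -/
def TwistLift.mirrorY (T : TwistLift) : TwistLift where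
  F := reflY.trans (T.F.symm.trans reflY)
  deck z := by
    have h : reflY (deckT z) = deckT (reflY z) := rfl
    show reflY (T.F.symm (reflY (deckT z))) = deckT (reflY (T.F.symm (reflY z)))
    rw [h, T.deck_symm]
    rfl
  bot z := by
    have := T.top_symm (reflY z)
    simpa using this
  top z := by
    have := T.bot_symm (reflY z)
    simpa using this
  twist z w h1 h2 := T.itwist (reflY w) (reflY z) h1.symm (by simpa using h2)
  itwist z w h1 h2 := T.twist (reflY w) (reflY z) h1.symm (by simpa using h2)
  botmono z w h1 h2 := by
    have := T.topmono (T.F.symm (reflY z)) (T.F.symm (reflY w))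
      (by rw [T.top_symm]; simpa using h1) (by rw [T.top_symm]; simpa using h2)
    simp only [Homeomorph.apply_symm_apply] at this
    exact this.symm
  topmono z w h1 h2 := by
    have := T.botmono (T.F.symm (reflY z)) (T.F.symm (reflY w))
      (by rw [T.bot_symm]; simpa using h1) (by rw [T.bot_symm]; simpa using h2)
    simp only [Homeomorph.apply_symm_apply] at this
    exact this.symm
  nw := T.conj_nw reflY reflY_reflY fun _ h => h.reflY
  graph a ha hp hi := by
    have := T.graph (fun x => unitInterval.symm (a x)) (by fun_prop)
      (fun x => by rw [hp x]) (by
        intro z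
        have := hi (reflY (T.F z))
        simp only [Homeomorph.trans_apply, reflY_reflY, Homeomorph.symm_apply_apply] at this
        simp only [reflY_apply] at this
        rw [unitIntervalSymm_eq_iff, unitIntervalSymm_eq_iff] at this
        exact this.symm)
    rcases this with h | h
    · exact Or.inr fun x => by simpa using h x
    · exact Or.inl fun x => by simpa using h x

lemma joinedIn_of_path {X : Type*} [TopologicalSpace X] {S : Set X} {x y : X}
    (γ : unitInterval → X) (hγ : Continuous γ) (h0 : γ 0 = x) (h1 : γ 1 = y)
    (h : ∀ t, γ t ∈ S) : JoinedIn S x y :=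
  ⟨⟨⟨γ, hγ⟩, h0, h1⟩, h⟩

/-! ### Angles of pairs of points joined to the top line -/

/-- The displacement vector from `p` to `q`. -/
def dv (p q : StripA) : ℂ := ⟨q.1 - p.1, (q.2 : ℝ) - (p.2 : ℝ)⟩

@[simp] lemma dv_re (p q : StripA) : (dv p q).re = q.1 - p.1 := rfl
@[simp] lemma dv_im (p q : StripA) : (dv p q).im = (q.2 : ℝ) - p.2 := rfl

lemma dv_ne_zero {p q : StripA} (h : q ≠ p) : dv p q ≠ 0 := by
  intro h0
  have h1 := congrArg Complex.re h0
  have h2 := congrArg Complex.im h0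
  simp only [dv_re, dv_im, Complex.zero_re, Complex.zero_im, sub_eq_zero] at h1 h2
  exact h (Prod.ext h1 (Subtype.ext h2))

lemma dv_eq (p q : StripA) :
    dv p q = ((q.1 - p.1 : ℝ) : ℂ) + (((q.2 : ℝ) - p.2 : ℝ) : ℂ) * Complex.I := by
  apply Complex.ext <;> simp

@[fun_prop]
lemma Continuous.dv {X : Type*} [TopologicalSpace X] {f g : X → StripA} (hf : Continuous f)
    (hg : Continuous g) : Continuous fun x => dv (f x) (g x) := by
  simp only [dv_eq]
  fun_prop

/-- Pairs of a point `z` outside of `K` and a determination of the angle from `p` to `z`. -/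
def AngSet (K : Set StripA) (p : StripA) : Set (StripA × ℝ) :=
  {x | x.1 ∉ K ∧ x.1 ≠ p ∧ (x.2 : Real.Angle) = ((dv p x.1).arg : Real.Angle)}

/-- The angle `θ` from `p` to `q` determined by a path from the top line to `q` avoiding `K`. -/
def HasAng (K : Set StripA) (p q : StripA) (θ : ℝ) : Prop :=
  ∃ c a, c.2 = 1 ∧ a ∈ Icc 0 Real.pi ∧ JoinedIn (AngSet K p) (c, a) (q, θ)

/-- The angle `θ` from `p` to `q` determined by a path from the bottom line to `p` in `U`. -/
def DualAng (U : Set StripA) (p q : StripA) (θ : ℝ) : Prop :=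
  ∃ c a, c.2 = 0 ∧ a ∈ Icc 0 Real.pi ∧
    JoinedIn {x : StripA × ℝ | x.1 ∈ U ∧ x.1 ≠ q ∧
      (x.2 : Real.Angle) = ((dv x.1 q).arg : Real.Angle)} (c, a) (p, θ)

/-- The points joined to the top line in the complement of `K`. -/
def TopComp (K : Set StripA) : Set StripA := {q | ∃ c, c.2 = 1 ∧ JoinedIn Kᶜ c q}

/-- Every point of `K` is joined to the bottom line in any invariant neighborhood of `K`. -/
def BotConn (K : Set StripA) : Prop :=
  ∀ W, IsOpen W → DeckInv W → K ⊆ W → ∀ p ∈ K, ∃ c, c.2 = 0 ∧ JoinedIn W c p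

lemma DeckInv.add_int {K : Set StripA} (h : DeckInv K) (n : ℤ) (z : StripA) :
    (z.1 + n, z.2) ∈ K ↔ z ∈ K := by
  induction n using Int.induction_on with
  | zero => simp
  | succ k ih =>
    rw [← ih, ← h (z.1 + (k : ℤ), z.2)]
    simp [deckT, add_assoc]
  | pred k ih =>
    rw [← ih, ← h (z.1 + ((-(k : ℤ) - 1 : ℤ) : ℝ), z.2)]
    simp [deckT, add_assoc]

lemma annProj_eq_iff {z w : StripA} :
    annProj z = annProj w ↔ ∃ n : ℤ, w = (z.1 + n, z.2) := by
  simp only [annProj, Prod.mk.injEq]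
  constructor
  · rintro ⟨h1, h2⟩
    have := QuotientAddGroup.eq.1 h1
    obtain ⟨n, hn⟩ := AddSubgroup.mem_zmultiples_iff.1 this
    refine ⟨n, Prod.ext ?_ h2.symm⟩
    simp at hn
    simp [hn]
  · rintro ⟨n, rfl⟩
    refine ⟨?_, rfl⟩
    apply QuotientAddGroup.eq.2
    exact AddSubgroup.mem_zmultiples_iff.2 ⟨n, by simp⟩

lemma DeckInv.of_annProj_eq {K : Set StripA} (h : DeckInv K) {z w : StripA}
    (hzw : annProj z = annProj w) (hz : z ∈ K) : w ∈ K := by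
  obtain ⟨n, rfl⟩ := annProj_eq_iff.1 hzw
  exact (h.add_int n z).2 hz

lemma continuous_annProj : Continuous annProj := by
  unfold annProj
  exact (AddCircle.continuous_mk' 1 |>.comp continuous_fst).prodMk continuous_snd

lemma annProj_deckT (z : StripA) : annProj (deckT z) = annProj z :=
  (annProj_eq_iff.2 ⟨1, by simp [deckT]⟩).symm

/-- The set of points whose deck orbit avoids `S`. -/
def offOrbit (S : Set StripA) : Set StripA := {z | annProj z ∉ annProj '' S}

lemma isOpen_offOrbit {S : Set StripA} (hS : IsCompact S) : IsOpen (offOrbit S) :=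
  (hS.image continuous_annProj).isClosed.isOpen_compl.preimage continuous_annProj

lemma deckInv_offOrbit (S : Set StripA) : DeckInv (offOrbit S) := by
  intro z
  simp [offOrbit, annProj_deckT]

lemma subset_offOrbit {S K : Set StripA} (hK : DeckInv K) (h : Disjoint S K) :
    K ⊆ offOrbit S := by
  rintro z hz ⟨w, hw, hwz⟩
  exact Set.disjoint_left.1 h hw (hK.of_annProj_eq hwz.symm hz)

lemma disjoint_offOrbit (S : Set StripA) : Disjoint S (offOrbit S) :=
  Set.disjoint_left.2 fun z hz hz' => hz' ⟨z, hz, rfl⟩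

lemma argLift_disjoint_paths {δ γ : unitInterval → StripA} (hδ : Continuous δ)
    (hγ : Continuous γ) (hd : ∀ s t, γ t ≠ δ s) (hδ0 : (δ 0).2 = 0) (hγ0 : (γ 0).2 = 1)
    {α β : unitInterval → ℝ} (hα : Continuous α) (lα : IsArgLift (fun t => dv (δ 1) (γ t)) α)
    (iα : α 0 ∈ Icc 0 Real.pi) (hβ : Continuous β)
    (lβ : IsArgLift (fun s => dv (δ s) (γ 1)) β) (iβ : β 0 ∈ Icc 0 Real.pi) : α 1 = β 1 := by
  have hV : Continuous fun x : unitInterval × unitInterval => dv (δ x.1) (γ x.2) := by fun_prop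
  have h0 : ∀ x : unitInterval × unitInterval, dv (δ x.1) (γ x.2) ≠ 0 :=
    fun x => dv_ne_zero (hd _ _)
  have him0 : ∀ t, 0 ≤ (dv (δ 0) (γ t)).im := fun t => by
    simp [hδ0, (γ t).2.2.1]
  obtain ⟨a, ha, ha'⟩ := exists_mem_Icc_coe_eq_arg (him0 0)
  obtain ⟨α₀, hα₀, lα₀, iα₀⟩ := exists_argLift_unitInterval
    (V := fun t => dv (δ 0) (γ t)) (by fun_prop) (fun t => h0 (0, t)) ha'
  rw [← iα₀] at ha
  have h1 := IsArgLift.mem_Icc_of_im_nonneg hα₀ lα₀ (fun t => h0 (0, t)) him0 ha 1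
  refine argLift_square (V := fun x => dv (δ x.1) (γ x.2)) hV h0 ?_ hα₀ lα₀ ha hα lα iα hβ lβ ?_
  · intro s
    simp [hγ0, (δ s).2.2.2]
  · exact eq_of_coe_angle_eq_of_mem_Icc ((lβ 0).trans (lα₀ 1).symm) iβ h1

lemma HasAng.dual {K U : Set StripA} {p q : StripA} {θ : ℝ} (h : HasAng K p q θ) (hp : p ∈ K)
    (hK : DeckInv K) (hc : BotConn K) (hU : IsOpen U) (hdU : DeckInv U) (hKU : K ⊆ U) :
    DualAng U p q θ := by
  obtain ⟨c, a, hc1, ha, Γ, hΓ⟩ := h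
  have hS : IsCompact (range fun t => (Γ t).1) := isCompact_range (by fun_prop)
  obtain ⟨d, hd, Δ, hΔ⟩ := hc (U ∩ offOrbit (range fun t => (Γ t).1))
    (hU.inter (isOpen_offOrbit hS))
    (fun z => and_congr (hdU z) (deckInv_offOrbit _ z))
    (subset_inter hKU (subset_offOrbit hK (Set.disjoint_left.2 (by
      rintro _ ⟨t, rfl⟩; exact (hΓ t).1)))) p hp
  have hdisj : ∀ s t, (Γ t).1 ≠ Δ s := fun s t he =>
    Set.disjoint_left.1 (disjoint_offOrbit _) (mem_range_self t) (he ▸ (hΔ s).2)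
  have hΓ1 : (Γ 1).1 = q := by simp
  obtain ⟨b, hb, hb'⟩ := exists_mem_Icc_coe_eq_arg (v := dv (Δ 0) q) (by simp [hd, q.2.2.1])
  obtain ⟨β, hβ, lβ, iβ⟩ := exists_argLift_unitInterval (V := fun s => dv (Δ s) q)
    (by fun_prop) (fun s => dv_ne_zero (hΓ1 ▸ hdisj s 1)) hb'
  have key : (Γ 1).2 = β 1 := by
    refine argLift_disjoint_paths (δ := Δ) (γ := fun t => (Γ t).1) (α := fun t => (Γ t).2)
      (by fun_prop) (by fun_prop) hdisj (by simpa using hd) (by simpa using hc1) (by fun_prop)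
      ?_ (by simpa using ha) hβ ?_ (by rwa [iβ])
    · intro t
      simpa using (hΓ t).2.2
    · intro s
      simpa using lβ s
  refine ⟨d, b, hd, hb, ⟨⟨⟨fun s => (Δ s, β s), by fun_prop⟩, by simp [iβ], ?_⟩, ?_⟩⟩
  · simp [← key]
  · intro s
    exact ⟨(hΔ s).1, fun he => hdisj s 1 (by simpa using he.symm), lβ s⟩

lemma HasAng.unique {K : Set StripA} {p q : StripA} {θ θ' : ℝ} (hp : p ∈ K)
    (hK : DeckInv K) (hc : BotConn K) (h : HasAng K p q θ) (h' : HasAng K p q θ') : θ = θ' := by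
  obtain ⟨c, a, hc1, ha, Γ, hΓ⟩ := h'
  have hS : IsCompact (range fun t => (Γ t).1) := isCompact_range (by fun_prop)
  obtain ⟨d, b, hd, hb, Δ, hΔ⟩ := h.dual hp hK hc (isOpen_offOrbit hS) (deckInv_offOrbit _)
    (subset_offOrbit hK (Set.disjoint_left.2 (by rintro _ ⟨t, rfl⟩; exact (hΓ t).1)))
  have := argLift_disjoint_paths (δ := fun s => (Δ s).1) (γ := fun t => (Γ t).1)
    (α := fun t => (Γ t).2) (β := fun t => (Δ t).2) (by fun_prop) (by fun_prop)
    (fun s t he => Set.disjoint_left.1 (disjoint_offOrbit _) (mem_range_self t) (he ▸ (hΔ s).1))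
    (by simpa using hd) (by simpa using hc1) (by fun_prop)
    (fun t => by simpa using (hΓ t).2.2) (by simpa using ha) (by fun_prop)
    (fun t => by simpa using (hΔ t).2.2) (by simpa using hb)
  simpa using this.symm

lemma HasAng.of_path {K : Set StripA} {p c q : StripA} (hp : p ∈ K) (hc : c.2 = 1)
    (γ : Path c q) (hγ : ∀ t, γ t ∉ K) : ∃ α : unitInterval → ℝ, Continuous α ∧
      IsArgLift (fun t => dv p (γ t)) α ∧ α 0 ∈ Icc 0 Real.pi ∧ HasAng K p q (α 1) := by
  have hne : ∀ t, γ t ≠ p := fun t he => hγ t (he ▸ hp)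
  obtain ⟨a, ha, ha'⟩ := exists_mem_Icc_coe_eq_arg (v := dv p (γ 0)) (by simp [hc, p.2.2.2])
  obtain ⟨α, hα, lα, iα⟩ := exists_argLift_unitInterval (V := fun s => dv p (γ s))
    (by fun_prop) (fun s => dv_ne_zero (hne s)) ha'
  refine ⟨α, hα, lα, by rwa [iα], c, a, hc, ha,
    ⟨⟨⟨fun s => (γ s, α s), by fun_prop⟩, by simp [iα], by simp⟩, fun s => ⟨hγ s, hne s, lα s⟩⟩⟩

lemma HasAng.exists {K : Set StripA} {p q : StripA} (hp : p ∈ K) (hq : q ∈ TopComp K) :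
    ∃ θ, HasAng K p q θ := by
  obtain ⟨c, hc, γ, hγ⟩ := hq
  obtain ⟨α, -, -, -, h⟩ := HasAng.of_path hp hc γ hγ
  exact ⟨_, h⟩

lemma HasAng.mem_topComp {K : Set StripA} {p q : StripA} {θ : ℝ} (h : HasAng K p q θ) :
    q ∈ TopComp K := by
  obtain ⟨c, a, hc, -, Γ, hΓ⟩ := h
  exact ⟨c, hc, ⟨⟨⟨fun t => (Γ t).1, by fun_prop⟩, by simp, by simp⟩, fun t => (hΓ t).1⟩⟩

lemma HasAng.coe_eq {K : Set StripA} {p q : StripA} {θ : ℝ} (h : HasAng K p q θ) :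
    q ≠ p ∧ (θ : Real.Angle) = ((dv p q).arg : Real.Angle) := by
  obtain ⟨c, a, hc, -, hj⟩ := h
  exact hj.target_mem.2

lemma HasAng.of_top {K : Set StripA} {p q : StripA} (hp : p ∈ K) (hq : q ∉ K) (h1 : q.2 = 1) :
    ∃ θ ∈ Icc 0 Real.pi, HasAng K p q θ := by
  obtain ⟨a, ha, ha'⟩ := exists_mem_Icc_coe_eq_arg (v := dv p q) (by simp [h1, p.2.2.2])
  exact ⟨a, ha, q, a, h1, ha, JoinedIn.refl ⟨hq, fun he => hq (by rwa [← he] at hp), ha'⟩⟩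

/-! ### Deformation of pairs of points -/

/-- The point at time `t` of the straight segment from `p` to `q`. -/
def seg (p q : StripA) (t : unitInterval) : StripA :=
  ((1 - (t : ℝ)) * p.1 + t * q.1,
    ⟨(1 - (t : ℝ)) * p.2 + t * q.2,
      (convex_Icc (0:ℝ) 1) p.2.2 q.2.2 (sub_nonneg.2 t.2.2) t.2.1 (by ring)⟩)

@[simp] lemma seg_zero (p q : StripA) : seg p q 0 = p := by
  simp [seg]

@[simp] lemma seg_one (p q : StripA) : seg p q 1 = q := by
  simp [seg]

@[simp] lemma seg_self (p : StripA) (t : unitInterval) : seg p p t = p := by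
  refine Prod.ext ?_ (Subtype.ext ?_) <;> simp only [seg] <;> ring

@[fun_prop]
lemma Continuous.seg {X : Type*} [TopologicalSpace X] {f g : X → StripA} {h : X → unitInterval}
    (hf : Continuous f) (hg : Continuous g) (hh : Continuous h) :
    Continuous fun x => seg (f x) (g x) (h x) := by
  unfold _root_.seg
  refine Continuous.prodMk (by fun_prop) (Continuous.subtype_mk (by fun_prop) _)

lemma eventually_seg {p q : StripA} {P : StripA × StripA → Prop} (h : ∀ᶠ z in 𝓝 (p, q), P z) :
    ∀ᶠ z in 𝓝 (p, q), ∀ s t, P (seg p z.1 s, seg q z.2 t) := by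
  have h1 := IsCompact.eventually_forall_of_forall_eventually (x₀ := (p, q))
    (isCompact_univ (X := unitInterval × unitInterval))
    (P := fun z x => P (seg p z.1 x.1, seg q z.2 x.2)) ?_
  · filter_upwards [h1] with z hz s t using hz (s, t) (mem_univ _)
  · intro x _
    have hc : Continuous fun y : (StripA × StripA) × (unitInterval × unitInterval) =>
      (seg p y.1.1 y.2.1, seg q y.1.2 y.2.2) := by fun_prop
    have := hc.tendsto ((p, q), x)
    simp only [seg_self] at this
    exact this.eventually h

lemma HasAng.eventually_nhds {K : Set StripA} {p q : StripA} {θ : ℝ} (hK : IsClosed K)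
    (h : HasAng K p q θ) :
    ∀ᶠ z in 𝓝 (p, q), HasAng K z.1 z.2 (argNear (dv p q) θ (dv z.1 z.2)) := by
  obtain ⟨hqp, hθ⟩ := h.coe_eq
  have hv0 := dv_ne_zero hqp
  obtain ⟨c, a, hc, ha, Γ, hΓ⟩ := h
  have hqK : q ∉ K := by simpa using (hΓ 1).1
  have e1 : ∀ᶠ z in 𝓝 (p, q), dv z.1 z.2 / dv p q ∈ Complex.slitPlane := by
    have : Continuous fun z : StripA × StripA => dv z.1 z.2 := by fun_prop
    exact (this.tendsto (p, q)).eventually (argNear_nhds hv0)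
  have e2 : ∀ᶠ z : StripA × StripA in 𝓝 (p, q), z.2 ∉ K :=
    (continuous_snd.tendsto (p, q)).eventually (hK.isOpen_compl.mem_nhds hqK)
  have e3 : ∀ᶠ z : StripA × StripA in 𝓝 (p, q), z.1 ∉ range fun t => (Γ t).1 := by
    refine (continuous_fst.tendsto (p, q)).eventually
      (IsOpen.mem_nhds (IsCompact.isClosed ?_).isOpen_compl ?_)
    · exact isCompact_range (by fun_prop)
    · rintro ⟨t, ht⟩
      exact (hΓ t).2.1 ht
  filter_upwards [eventually_seg (e1.and (e2.and e3))] with z hz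
  have hne : ∀ s t, seg q z.2 t ≠ seg p z.1 s := by
    intro s t he
    have := (hz s t).1
    rw [he] at this
    have h0 : dv (seg p z.1 s) (seg p z.1 s) = 0 := by apply Complex.ext <;> simp
    rw [h0, zero_div] at this
    simp at this
  have hA : ∀ s t, ContinuousAt (argNear (dv p q) θ) (dv (seg p z.1 s) (seg q z.2 t)) :=
    fun s t => argNear_continuousAt (hz s t).1
  have hzΓ : ∀ t, (Γ t).1 ≠ z.1 := fun t he => (hz 1 1).2.2 ⟨t, by simpa using he⟩
  have step1 : HasAng K z.1 q (argNear (dv p q) θ (dv z.1 q)) := by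
    obtain ⟨a', ha', ha''⟩ := exists_mem_Icc_coe_eq_arg (v := dv z.1 (Γ 0).1)
      (by simp [hc, z.1.2.2.2])
    obtain ⟨α, hα, lα, iα⟩ := exists_argLift_unitInterval (V := fun s => dv z.1 (Γ s).1)
      (by fun_prop) (fun s => dv_ne_zero (hzΓ s)) ha''
    have key : α 1 = argNear (dv p q) θ (dv (seg p z.1 1) q) := by
      refine argLift_square (V := fun x => dv (seg p z.1 x.1) (Γ x.2).1)
        (α₀ := fun t => (Γ t).2) (ε := fun s => argNear (dv p q) θ (dv (seg p z.1 s) q))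
        (by fun_prop) ?_ ?_ (by fun_prop) ?_ (by simpa using ha) hα ?_ (by rwa [iα]) ?_ ?_ ?_
      · intro x
        exact dv_ne_zero fun he => (hz x.1 0).2.2 ⟨x.2, he⟩
      · intro s
        simp [hc, (seg p z.1 s).2.2.2]
      · intro t
        simpa using (hΓ t).2.2
      · intro t
        simpa using lα t
      · refine continuous_iff_continuousAt.2 fun s => ?_
        have h1 := hA s 0
        simp only [seg_zero] at h1
        have h2 : ContinuousAt (fun s => dv (seg p z.1 s) q) s :=
          Continuous.continuousAt (by fun_prop)
        exact ContinuousAt.comp (f := fun s => dv (seg p z.1 s) q) h1 h2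
      · intro s
        have := hne s 0
        simp only [seg_zero] at this
        simpa using argNear_coe hv0 (dv_ne_zero this) hθ
      · simp [argNear_self hv0]
    rw [seg_one] at key
    refine ⟨c, a', hc, ha', ⟨⟨⟨fun s => ((Γ s).1, α s), by fun_prop⟩, by simp [iα], by simp [key]⟩,
      fun s => ⟨(hΓ s).1, hzΓ s, lα s⟩⟩⟩
  obtain ⟨c', a', hc', ha', hj⟩ := step1
  refine ⟨c', a', hc', ha', hj.trans ⟨⟨⟨fun t => (seg q z.2 t,
    argNear (dv p q) θ (dv z.1 (seg q z.2 t))), ?_⟩, by simp, by simp⟩, ?_⟩⟩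
  · refine Continuous.prodMk (by fun_prop) (continuous_iff_continuousAt.2 fun t => ?_)
    have h1 := hA 1 t
    simp only [seg_one] at h1
    have h2 : ContinuousAt (fun t => dv z.1 (seg q z.2 t)) t :=
      Continuous.continuousAt (by fun_prop)
    exact ContinuousAt.comp (f := fun t => dv z.1 (seg q z.2 t)) h1 h2
  · intro t
    have := hne 1 t
    simp only [seg_one] at this
    exact ⟨(hz 1 t).2.1, this, argNear_coe hv0 (dv_ne_zero this) hθ⟩

lemma tendsto_argNear {p q : StripA} (hqp : q ≠ p) (θ : ℝ) :
    Tendsto (fun z : StripA × StripA => argNear (dv p q) θ (dv z.1 z.2)) (𝓝 (p, q)) (𝓝 θ) := by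
  have h0 := dv_ne_zero hqp
  have h1 : ContinuousAt (argNear (dv p q) θ) (dv p q) :=
    argNear_continuousAt (argNear_nhds h0).self_of_nhds
  have h2 : Continuous fun z : StripA × StripA => dv z.1 z.2 := by fun_prop
  have h3 : Tendsto (argNear (dv p q) θ) (𝓝 (dv p q)) (𝓝 θ) := by
    simpa [ContinuousAt, argNear_self h0] using h1
  exact h3.comp (h2.tendsto (p, q))

lemma DeckInv.closure {K : Set StripA} (h : DeckInv K) : DeckInv (closure K) := by
  let e : StripA ≃ₜ StripA :=
    { toFun := deckT
      invFun := fun z => (z.1 - 1, z.2)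
      left_inv := fun z => by simp [deckT]
      right_inv := fun z => by simp [deckT]
      continuous_toFun := continuous_deckT
      continuous_invFun := by fun_prop }
  have h1 : e ⁻¹' K = K := by ext z; exact h z
  intro z
  have h2 := e.preimage_closure K
  rw [h1] at h2
  exact Set.ext_iff.1 h2 z

lemma DeckInv.topComp {K : Set StripA} (hK : DeckInv K) : DeckInv (TopComp K) := by
  intro z
  constructor
  · rintro ⟨c, hc, γ, hγ⟩
    refine ⟨(c.1 - 1, c.2), hc, joinedIn_of_path (fun t => ((γ t).1 - 1, (γ t).2)) (by fun_prop)
      (by simp) (by simp only [γ.target]; simp [deckT]) fun t ht => hγ t ?_⟩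
    have := (hK _).2 ht
    simpa [deckT] using this
  · rintro ⟨c, hc, γ, hγ⟩
    exact ⟨deckT c, hc, ⟨⟨⟨fun t => deckT (γ t), continuous_deckT.comp γ.continuous⟩, by simp,
      by simp⟩, fun t ht => hγ t ((hK _).1 ht)⟩⟩

lemma HasAng.deckT {K : Set StripA} (hK : DeckInv K) {p q : StripA} {θ : ℝ}
    (h : HasAng K p q θ) : HasAng K (deckT p) (deckT q) θ := by
  obtain ⟨c, a, hc, ha, Γ, hΓ⟩ := h
  refine ⟨_root_.deckT c, a, hc, ha, joinedIn_of_path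
    (fun t => (_root_.deckT (Γ t).1, (Γ t).2))
    ((continuous_deckT.comp (by fun_prop)).prodMk (by fun_prop)) (by simp) (by simp) ?_⟩
  intro t
  obtain ⟨h1, h2, h3⟩ := hΓ t
  refine ⟨fun h => h1 ((hK _).1 h), fun h => h2 (deckT_injective h), h3.trans ?_⟩
  simp [dv, _root_.deckT]

lemma HasAng.deckT_inv {K : Set StripA} (hK : DeckInv K) {p q : StripA} {θ : ℝ}
    (h : HasAng K p (_root_.deckT q) θ) : HasAng K (p.1 - 1, p.2) q θ := by
  obtain ⟨c, a, hc, ha, Γ, hΓ⟩ := h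
  refine ⟨(c.1 - 1, c.2), a, hc, ha, joinedIn_of_path (fun t => (((Γ t).1.1 - 1, (Γ t).1.2), (Γ t).2))
    (by fun_prop) (by simp) (by simp only [Γ.target]; simp [_root_.deckT]) ?_⟩
  intro t
  obtain ⟨h1, h2, h3⟩ := hΓ t
  refine ⟨fun h => h1 ?_, fun h => h2 ?_, h3.trans ?_⟩
  · have := (hK _).2 h
    simpa [_root_.deckT] using this
  · have := congrArg _root_.deckT h
    simpa [_root_.deckT] using this
  · simp [dv]

/-! ### Effect of the reflections on angles -/

lemma coe_pi_sub_eq_arg {v w : ℂ} {θ : ℝ} (hv : v ≠ 0) (hw : w.re = -v.re ∧ w.im = v.im)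
    (h : (θ : Real.Angle) = (v.arg : Real.Angle)) :
    ((Real.pi - θ : ℝ) : Real.Angle) = (w.arg : Real.Angle) := by
  have : w = -(starRingEnd ℂ v) := by apply Complex.ext <;> simp [hw.1, hw.2]
  rw [this, Complex.arg_neg_coe_angle (by simpa using hv), Complex.arg_conj_coe_angle,
    Real.Angle.coe_sub, h]
  abel

lemma HasAng.reflX {K : Set StripA} {p q : StripA} {θ : ℝ} (h : HasAng K p q θ) :
    HasAng (reflX ⁻¹' K) (reflX p) (reflX q) (Real.pi - θ) := by
  obtain ⟨c, a, hc, ha, Γ, hΓ⟩ := h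
  refine ⟨_root_.reflX c, Real.pi - a, hc, ⟨by linarith [ha.2], by linarith [ha.1]⟩,
    joinedIn_of_path (fun t => (_root_.reflX (Γ t).1, Real.pi - (Γ t).2)) (by fun_prop) (by simp)
      (by simp) ?_⟩
  intro t
  obtain ⟨h1, h2, h3⟩ := hΓ t
  refine ⟨fun h => h1 ?_, fun h => h2 (_root_.reflX.injective h),
    coe_pi_sub_eq_arg (dv_ne_zero h2) ⟨?_, ?_⟩ h3⟩
  · simpa using h
  · simp only [dv_re, reflX_apply]; ring
  · simp

lemma DualAng.reflY {U : Set StripA} {p q : StripA} {θ : ℝ} (h : DualAng U p q θ) :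
    HasAng (reflY ⁻¹' Uᶜ) (reflY q) (reflY p) (Real.pi - θ) := by
  obtain ⟨c, a, hc, ha, Γ, hΓ⟩ := h
  refine ⟨_root_.reflY c, Real.pi - a, by simp [hc], ⟨by linarith [ha.2], by linarith [ha.1]⟩,
    joinedIn_of_path (fun t => (_root_.reflY (Γ t).1, Real.pi - (Γ t).2)) (by fun_prop) (by simp)
      (by simp) ?_⟩
  intro t
  obtain ⟨h1, h2, h3⟩ := hΓ t
  refine ⟨fun h => ?_, fun h => h2 (_root_.reflY.injective h),
    coe_pi_sub_eq_arg (dv_ne_zero h2.symm) ⟨?_, ?_⟩ h3⟩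
  · simp only [mem_preimage, reflY_reflY] at h
    exact h h1
  · simp
  · simp

/-- Closed invariant sets of the strip all of whose points are linked to the bottom line. -/
structure LowerSide (K : Set StripA) : Prop where
  closed : IsClosed K
  deck : DeckInv K
  conn : BotConn K

/-! ### The twist condition and angles -/

lemma cos_sub_int_mul_pi_pos {v w : ℂ} {a b : ℝ} {k : ℤ} (hv : v ≠ 0)
    (ha : (a : Real.Angle) = (v.arg : Real.Angle)) (hb : (b : Real.Angle) = (w.arg : Real.Angle))
    (hak : a = Real.pi / 2 + k * Real.pi) (h1 : v.re = 0 → 0 < v.im → 0 < w.re)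
    (h2 : v.re = 0 → v.im < 0 → w.re < 0) : 0 < Real.cos (b - k * Real.pi) := by
  obtain ⟨hvr, hvi⟩ := re_im_of_coe_eq_arg ha
  obtain ⟨hwr, -⟩ := re_im_of_coe_eq_arg hb
  have hn : 0 < ‖v‖ := norm_pos_iff.2 hv
  have hc : Real.cos a = 0 := by
    rw [hak, Real.cos_add_int_mul_pi, Real.cos_pi_div_two, mul_zero]
  have hs : Real.sin a = (-1) ^ k := by
    rw [hak, Real.sin_add_int_mul_pi, Real.sin_pi_div_two, mul_one]
  rw [hc, mul_zero] at hvr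
  rw [Real.cos_sub_int_mul_pi]
  rcases Int.even_or_odd k with he | ho
  · rw [he.neg_one_zpow] at hs ⊢
    have := h1 hvr (by rw [hvi, hs]; linarith)
    rw [hwr] at this
    rw [one_mul]
    exact pos_of_mul_pos_right this (norm_nonneg _)
  · rw [ho.neg_one_zpow] at hs ⊢
    have := h2 hvr (by rw [hvi, hs]; linarith)
    rw [hwr] at this
    by_contra! hcon
    nlinarith [norm_nonneg w]

lemma lt_or_lt_of_cos_pos {x : ℝ} (h : 0 < Real.cos x) :
    x < Real.pi / 2 ∨ Real.pi / 2 + Real.pi < x := by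
  by_contra! hx
  exact absurd (Real.cos_nonpos_of_pi_div_two_le_of_le hx.1 (by linarith [hx.2])) (not_le.2 h)

lemma lt_or_lt_of_cos_neg {x : ℝ} (h : Real.cos x < 0) :
    x < -(Real.pi / 2) ∨ Real.pi / 2 < x := by
  by_contra! hx
  exact absurd (Real.cos_nonneg_of_neg_pi_div_two_le_of_le (by linarith [hx.1]) hx.2) (not_le.2 h)

namespace TwistLift

variable (T : TwistLift)

lemma re_pos_of_im_pos {p q : StripA} (h : (dv p q).re = 0) (h' : 0 < (dv p q).im) :
    0 < (dv (T.F p) (T.F q)).re := by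
  simp only [dv_re, dv_im, sub_pos, sub_eq_zero] at *
  exact T.twist p q h.symm h'

lemma re_neg_of_im_neg {p q : StripA} (h : (dv p q).re = 0) (h' : (dv p q).im < 0) :
    (dv (T.F p) (T.F q)).re < 0 := by
  simp only [dv_re, dv_im, sub_neg, sub_eq_zero] at *
  exact T.twist q p h h'

lemma re_neg_of_im_pos_symm {p q : StripA} (h : (dv (T.F p) (T.F q)).re = 0)
    (h' : 0 < (dv (T.F p) (T.F q)).im) : (dv p q).re < 0 := by
  simp only [dv_re, dv_im, sub_pos, sub_neg, sub_eq_zero] at *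
  have := T.itwist (T.F p) (T.F q) h.symm h'
  simpa using this

lemma re_pos_of_im_neg_symm {p q : StripA} (h : (dv (T.F p) (T.F q)).re = 0)
    (h' : (dv (T.F p) (T.F q)).im < 0) : 0 < (dv p q).re := by
  simp only [dv_re, dv_im, sub_pos, sub_neg, sub_eq_zero] at *
  have := T.itwist (T.F q) (T.F p) h h'
  simpa using this

/-- The image by `F` turns angles to the right across the vertical directions. -/
lemma angle_step {p : StripA} {γ : unitInterval → StripA} (hne : ∀ t, γ t ≠ p) (h1 : (γ 0).2 = 1) {α β : unitInterval → ℝ} (hα : Continuous α)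
    (lα : IsArgLift (fun t => dv p (γ t)) α) (iα : α 0 ∈ Icc 0 Real.pi) (hβ : Continuous β)
    (lβ : IsArgLift (fun t => dv (T.F p) (T.F (γ t))) β) (iβ : β 0 ∈ Icc 0 Real.pi)
    (t : unitInterval) (k : ℤ) (hk : α t ≤ Real.pi / 2 + k * Real.pi) :
    β t < Real.pi / 2 + k * Real.pi := by
  have hpi := Real.pi_pos
  have hne' : ∀ t, T.F (γ t) ≠ T.F p := fun t he => hne t (T.F.injective he)
  have hA : ∀ t (k : ℤ), α t = Real.pi / 2 + k * Real.pi →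
      β t < Real.pi / 2 + k * Real.pi ∨ Real.pi / 2 + k * Real.pi + Real.pi < β t := by
    intro t k h
    have := lt_or_lt_of_cos_pos (cos_sub_int_mul_pi_pos (dv_ne_zero (hne t)) (lα t) (lβ t) h
      T.re_pos_of_im_pos T.re_neg_of_im_neg)
    rcases this with h | h
    · left; linarith
    · right; linarith
  have hB : ∀ t (k : ℤ), β t = Real.pi / 2 + k * Real.pi →
      α t < Real.pi / 2 + k * Real.pi - Real.pi ∨ Real.pi / 2 + k * Real.pi < α t := by
    intro t k h
    have h2 : (α t : Real.Angle) = ((dv p (γ t)).arg : Real.Angle) := lα t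
    have h3 : ((α t + Real.pi : ℝ) : Real.Angle) = ((-dv p (γ t)).arg : Real.Angle) := by
      rw [Complex.arg_neg_coe_angle (dv_ne_zero (hne t)), Real.Angle.coe_add, h2]
    have := cos_sub_int_mul_pi_pos (dv_ne_zero (hne' t)) (lβ t) h3 h
      (fun a b => by simpa using T.re_neg_of_im_pos_symm a b)
      (fun a b => by simpa using T.re_pos_of_im_neg_symm a b)
    have h4 : Real.cos (α t - k * Real.pi) < 0 := by
      rw [show α t + Real.pi - k * Real.pi = α t - k * Real.pi + Real.pi by ring,
        Real.cos_add_pi] at this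
      linarith
    rcases lt_or_lt_of_cos_neg h4 with h | h
    · left; linarith
    · right; linarith
  let Bad : Set unitInterval :=
    {t | ∃ k : ℤ, α t ≤ Real.pi / 2 + k * Real.pi ∧ Real.pi / 2 + k * Real.pi ≤ β t}
  have hBadEq : Bad = ⋃ k : ℤ, {t | α t < Real.pi / 2 + k * Real.pi} ∩
      {t | Real.pi / 2 + k * Real.pi < β t} := by
    ext t
    simp only [Bad, mem_ofPred_eq, mem_iUnion, mem_inter_iff]
    constructor
    · rintro ⟨k, h1, h2⟩
      rcases h1.lt_or_eq with h1 | h1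
      · rcases h2.lt_or_eq with h2 | h2
        · exact ⟨k, h1, h2⟩
        · refine ⟨k - 1, ?_, ?_⟩
          · rcases hB t k h2.symm with h | h
            · push_cast; linarith
            · linarith
          · push_cast; linarith
      · refine ⟨k + 1, ?_, ?_⟩
        · push_cast; linarith
        · rcases hA t k h1 with h | h
          · linarith
          · push_cast; linarith
    · rintro ⟨k, h1, h2⟩
      exact ⟨k, h1.le, h2.le⟩
  have hopen : IsOpen Bad := by
    rw [hBadEq]
    exact isOpen_iUnion fun k => (isOpen_lt hα continuous_const).inter
      (isOpen_lt continuous_const hβ)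
  have hclosed : IsClosed Bad := by
    rw [← isOpen_compl_iff]
    have : Badᶜ = ⋃ k : ℤ, {t | Real.pi / 2 + k * Real.pi < α t} ∩
        {t | β t < Real.pi / 2 + (k + 1) * Real.pi} := by
      ext t
      simp only [Bad, mem_compl_iff, mem_ofPred_eq, mem_iUnion, mem_inter_iff]
      constructor
      · intro h
        push Not at h
        refine ⟨⌈(α t - Real.pi / 2) / Real.pi⌉ - 1, ?_, ?_⟩
        · have := Int.ceil_lt_add_one ((α t - Real.pi / 2) / Real.pi)
          rw [← sub_lt_iff_lt_add, lt_div_iff₀ hpi] at this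
          push_cast
          linarith
        · have h3 := Int.le_ceil ((α t - Real.pi / 2) / Real.pi)
          rw [div_le_iff₀ hpi] at h3
          have := h ⌈(α t - Real.pi / 2) / Real.pi⌉ (by linarith)
          push_cast
          linarith
      · rintro ⟨k, h1, h2⟩ ⟨j, h3, h4⟩
        have h5 : (k : ℝ) < j := by
          by_contra! hcon
          nlinarith
        have h6 : (k : ℝ) + 1 ≤ j := by exact_mod_cast Int.add_one_le_iff.2 (by exact_mod_cast h5)
        nlinarith
    rw [this]
    exact isOpen_iUnion fun k => (isOpen_lt continuous_const hα).inter
      (isOpen_lt hβ continuous_const)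
  have h0 : (0 : unitInterval) ∉ Bad := by
    rintro ⟨k, h2, h3⟩
    have hk1 : (-1 : ℝ) < k := by
      by_contra! hcon
      nlinarith [iα.1]
    have hk2 : (k : ℝ) < 1 := by
      by_contra! hcon
      nlinarith [iβ.2]
    have hk0 : k = 0 := by
      have : (-1 : ℤ) < k := by exact_mod_cast hk1
      have : k < (1 : ℤ) := by exact_mod_cast hk2
      omega
    subst hk0
    simp only [Int.cast_zero, zero_mul, add_zero] at h2 h3
    have e1 : p.1 ≤ (γ 0).1 := by
      have := (re_im_of_coe_eq_arg (lα 0)).1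
      have hc := Real.cos_nonneg_of_neg_pi_div_two_le_of_le (x := α 0) (by linarith [iα.1]) h2
      rw [dv_re] at this
      nlinarith [mul_nonneg (norm_nonneg (dv p (γ 0))) hc]
    have e2 : (T.F (γ 0)).1 ≤ (T.F p).1 := by
      have := (re_im_of_coe_eq_arg (lβ 0)).1
      have hc := Real.cos_nonpos_of_pi_div_two_le_of_le (x := β 0) h3 (by linarith [iβ.2])
      rw [dv_re] at this
      nlinarith [mul_nonneg (norm_nonneg (dv (T.F p) (T.F (γ 0)))) (neg_nonneg.2 hc)]
    by_cases hp : p.2 = 1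
    · rcases e1.lt_or_eq with e | e
      · exact absurd ((T.topmono p (γ 0) hp h1).2 e) (not_lt.2 e2)
      · exact hne 0 (Prod.ext e.symm (h1.trans hp.symm))
    · have hlt := T.twist p (p.1, 1) rfl (lt_of_le_of_ne (unitInterval.le_one' (t := p.2)) hp)
      have hle : (T.F (p.1, 1)).1 ≤ (T.F (γ 0)).1 := by
        rw [← not_lt, T.topmono (γ 0) (p.1, 1) h1 rfl]
        exact not_lt.2 e1
      linarith
  have hempty : Bad = ∅ := by
    rcases isClopen_iff.1 ⟨hclosed, hopen⟩ with h | h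
    · exact h
    · rw [h] at h0; simp at h0
  by_contra! hcon
  have : t ∈ Bad := ⟨k, hk, hcon⟩
  rw [hempty] at this
  exact this

lemma hasAng_step {K K' : Set StripA} {p q : StripA} {θ : ℝ} (hKK' : ∀ z, T.F z ∈ K' → z ∈ K)
    (h : HasAng K p q θ) : ∃ θ', HasAng K' (T.F p) (T.F q) θ' ∧
      ∀ k : ℤ, θ ≤ Real.pi / 2 + k * Real.pi → θ' < Real.pi / 2 + k * Real.pi := by
  obtain ⟨c, a, hc, ha, Γ, hΓ⟩ := h
  have hc' : (T.F c).2 = 1 := (T.top c).2 hc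
  have hne' : ∀ t, T.F (Γ t).1 ≠ T.F p := fun t he => (hΓ t).2.1 (T.F.injective he)
  have hΓ0 : (Γ 0).1 = c := by simp
  obtain ⟨b, hb, hb'⟩ := exists_mem_Icc_coe_eq_arg (v := dv (T.F p) (T.F (Γ 0).1))
    (by simp [hc', (T.F p).2.2.2])
  have hTF := T.F.continuous
  obtain ⟨β, hβ, lβ, iβ⟩ := exists_argLift_unitInterval
    (V := fun t => dv (T.F p) (T.F (Γ t).1)) (by fun_prop) (fun t => dv_ne_zero (hne' t)) hb'
  refine ⟨β 1, ⟨T.F c, b, hc', hb, joinedIn_of_path (fun t => (T.F (Γ t).1, β t)) (by fun_prop)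
    (by simp [iβ]) (by simp) fun t => ⟨fun h => (hΓ t).1 (hKK' _ h), hne' t, lβ t⟩⟩, ?_⟩
  intro k hk
  refine T.angle_step (γ := fun t => (Γ t).1) (α := fun t => (Γ t).2)
    (fun t => (hΓ t).2.1) (by simpa using hc) (by fun_prop) (fun t => (hΓ t).2.2)
    (by simpa using ha) hβ lβ (by rwa [iβ]) 1 k (by simpa using hk)

end TwistLift

/-! ### The bound on angles -/

lemma argLift_lt_of_re_ne_zero {V : unitInterval → ℂ} {α : unitInterval → ℝ} (hα : Continuous α)
    (lα : IsArgLift V α) (iα : α 0 ∈ Icc 0 Real.pi) (hre : ∀ t, (V t).re ≠ 0)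
    (t : unitInterval) : α t < 3 * Real.pi / 2 := by
  by_contra! h
  obtain ⟨s, hs⟩ : 3 * Real.pi / 2 ∈ range α :=
    (isPreconnected_range hα).ordConnected.out (mem_range_self 0) (mem_range_self t)
      ⟨by linarith [iα.2, Real.pi_pos], h⟩
  apply hre s
  rw [(re_im_of_coe_eq_arg (lα s)).1, hs, show 3 * Real.pi / 2 = Real.pi / 2 + Real.pi by ring,
    Real.cos_add_pi, Real.cos_pi_div_two]
  simp

lemma eventually_angle_lt {K : Set StripA} (hK : LowerSide K) {q : StripA}
    (hq : q ∈ TopComp K) (h : ∀ p ∈ K, ∀ θ, HasAng K p q θ → θ < 3 * Real.pi / 2) :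
    ∀ᶠ q' in 𝓝 q, ∀ p ∈ K, ∀ θ, HasAng K p q' θ → θ < 3 * Real.pi / 2 := by
  have hq' := hq
  obtain ⟨c, hc, γ, hγ⟩ := hq'
  obtain ⟨M, hM⟩ : ∃ M : ℝ, ∀ t, |(γ t).1| < M := by
    obtain ⟨M, hM⟩ := (isCompact_range (f := fun t => |(γ t).1|) (by fun_prop)).bddAbove
    exact ⟨M + 1, fun t => by linarith [hM (mem_range_self t)]⟩
  have hqM : |q.1| < M := by simpa using hM 1
  have hqK : q ∉ K := by simpa using hγ 1
  have e1 : ∀ᶠ q' in 𝓝 q, ∀ t, seg q q' t ∉ K ∧ |(seg q q' t).1| < M := by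
    have : ∀ᶠ z : StripA × StripA in 𝓝 (q, q), z.2 ∉ K ∧ |z.2.1| < M := by
      refine Filter.Eventually.and ?_ ?_
      · exact (continuous_snd.tendsto (q, q)).eventually (hK.closed.isOpen_compl.mem_nhds hqK)
      · exact (isOpen_lt (by fun_prop) continuous_const).mem_nhds hqM
    have h2 := eventually_seg this
    have h3 : Tendsto (fun q' : StripA => (q', q')) (𝓝 q) (𝓝 (q, q)) :=
      (continuous_id.prodMk continuous_id).tendsto q
    filter_upwards [h3.eventually h2] with q' hq' t using hq' 0 t
  have hC : IsCompact (K ∩ (Icc (-M) M ×ˢ univ)) :=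
    (isCompact_Icc.prod isCompact_univ).inter_left hK.closed
  have e2 : ∀ᶠ q' in 𝓝 q, ∀ p ∈ K ∩ (Icc (-M) M ×ˢ univ), p ∈ K →
      ∀ θ, HasAng K p q' θ → θ < 3 * Real.pi / 2 := by
    refine hC.eventually_forall_of_forall_eventually (x₀ := q)
      (P := fun q' p => p ∈ K → ∀ θ, HasAng K p q' θ → θ < 3 * Real.pi / 2) ?_
    intro p hp
    obtain ⟨θ, hθ⟩ := HasAng.exists hp.1 hq
    have hlt := h p hp.1 θ hθ
    have h1 := hθ.eventually_nhds hK.closed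
    have h2 := (tendsto_argNear hθ.coe_eq.1 θ).eventually (gt_mem_nhds hlt)
    have h3 : Tendsto (fun z : StripA × StripA => (z.2, z.1)) (𝓝 (q, p)) (𝓝 (p, q)) :=
      (continuous_snd.prodMk continuous_fst).tendsto (q, p)
    filter_upwards [h3.eventually h1, h3.eventually h2] with z hz1 hz2 hzK θ' hθ'
    rw [hθ'.unique hzK hK.deck hK.conn hz1]
    exact hz2
  filter_upwards [e1, e2] with q' h1 h2 p hp θ hθ
  by_cases hpM : p.1 ∈ Icc (-M) M
  · exact h2 p ⟨hp, hpM, mem_univ _⟩ hp θ hθ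
  · let η : Path q q' := ⟨⟨fun t => seg q q' t, by fun_prop⟩, by simp, by simp⟩
    have hall : ∀ t, (γ.trans η) t ∉ K ∧ |((γ.trans η) t).1| < M := by
      intro t
      have : (γ.trans η) t ∈ range γ ∪ range η := by
        rw [← Path.trans_range]; exact mem_range_self t
      rcases this with ⟨s, hs⟩ | ⟨s, hs⟩
      · rw [← hs]; exact ⟨hγ s, hM s⟩
      · rw [← hs]; exact h1 s
    obtain ⟨α, hα, lα, iα, hA⟩ := HasAng.of_path hp hc (γ.trans η) fun t => (hall t).1
    rw [hθ.unique hp hK.deck hK.conn hA]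
    refine argLift_lt_of_re_ne_zero hα lα iα (fun t h0 => hpM ?_) 1
    rw [dv_re, sub_eq_zero] at h0
    rw [← h0]
    exact abs_le.1 (hall t).2.le

lemma eventually_joinedIn {W : Set StripA} (hW : IsOpen W) {q : StripA} (hq : q ∈ W) :
    ∀ᶠ q' in 𝓝 q, JoinedIn W q q' := by
  have h1 : ∀ᶠ z : StripA × StripA in 𝓝 (q, q), z.2 ∈ W :=
    (continuous_snd.tendsto (q, q)).eventually (hW.mem_nhds hq)
  have h3 : Tendsto (fun q' : StripA => (q', q')) (𝓝 q) (𝓝 (q, q)) :=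
    (continuous_id.prodMk continuous_id).tendsto q
  filter_upwards [h3.eventually (eventually_seg h1)] with q' hq'
  exact joinedIn_of_path (fun t => seg q q' t) (by fun_prop) (by simp) (by simp)
    fun t => hq' 0 t

lemma TopComp.isOpen {K : Set StripA} (hK : IsClosed K) : IsOpen (TopComp K) := by
  rw [isOpen_iff_mem_nhds]
  rintro q ⟨c, hc, hj⟩
  filter_upwards [eventually_joinedIn hK.isOpen_compl hj.target_mem] with q' hq'
  exact ⟨c, hc, hj.trans hq'⟩

lemma TopComp.subset_compl (K : Set StripA) : TopComp K ⊆ Kᶜ := by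
  rintro q ⟨c, -, hj⟩
  exact hj.target_mem

namespace TwistLift

variable (T : TwistLift)

lemma topComp_forward {K : Set StripA} (hK : ∀ z ∈ K, T.F.symm z ∈ K) {q : StripA}
    (hq : q ∈ TopComp K) : T.F q ∈ TopComp K := by
  obtain ⟨c, hc, γ, hγ⟩ := hq
  refine ⟨T.F c, (T.top c).2 hc, joinedIn_of_path (fun t => T.F (γ t))
    (T.F.continuous.comp γ.continuous) (by simp) (by simp) fun t ht => hγ t ?_⟩
  simpa using hK _ ht

lemma angle_symm_gt {K : Set StripA} (hK : LowerSide K) (hinv : ∀ z ∈ K, T.F.symm z ∈ K)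
    {p q : StripA} (hp : p ∈ K) (hq : T.F.symm q ∈ TopComp K) {θ : ℝ} (h : HasAng K p q θ)
    (hθ : 3 * Real.pi / 2 ≤ θ) :
    ∃ θ₀, HasAng K (T.F.symm p) (T.F.symm q) θ₀ ∧ 3 * Real.pi / 2 < θ₀ := by
  obtain ⟨θ₀, hθ₀⟩ := HasAng.exists (hinv p hp) hq
  refine ⟨θ₀, hθ₀, ?_⟩
  obtain ⟨θ', h', hstep⟩ := T.hasAng_step (K' := K) (fun z hz => by simpa using hinv _ hz) hθ₀
  simp only [Homeomorph.apply_symm_apply] at h'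
  rw [h'.unique hp hK.deck hK.conn h] at hstep
  by_contra! hcon
  have := hstep 1 (by push_cast; linarith)
  push_cast at this
  linarith

/-- The set of points seen from `K` under an angle larger than `3π/2` is empty. -/
lemma angle_le {K : Set StripA} (hK : LowerSide K) (hinv : ∀ z ∈ K, T.F.symm z ∈ K)
    {p q : StripA} (hp : p ∈ K) {θ : ℝ} (h : HasAng K p q θ) : θ ≤ 3 * Real.pi / 2 := by
  let N := TopComp K
  let O : Set StripA := {q | ∃ p ∈ K, ∃ θ, HasAng K p q θ ∧ 3 * Real.pi / 2 < θ}
  have hON : O ⊆ N := by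
    rintro q ⟨p, -, θ, h, -⟩
    exact h.mem_topComp
  have hOopen : IsOpen O := by
    rw [isOpen_iff_mem_nhds]
    rintro q ⟨p, hp, θ, h, hθ⟩
    have h1 := h.eventually_nhds hK.closed
    have h2 := (tendsto_argNear h.coe_eq.1 θ).eventually (lt_mem_nhds hθ)
    have h3 : Tendsto (fun q' : StripA => (p, q')) (𝓝 q) (𝓝 (p, q)) :=
      (continuous_const.prodMk continuous_id).tendsto q
    filter_upwards [h3.eventually h1, h3.eventually h2] with q' h4 h5
    exact ⟨p, hp, _, h4, h5⟩
  have hOdeck : DeckInv O := by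
    intro z
    constructor
    · rintro ⟨p, hp, θ, h, hθ⟩
      refine ⟨(p.1 - 1, p.2), ?_, θ, h.deckT_inv hK.deck, hθ⟩
      rw [← hK.deck]
      simpa [deckT] using hp
    · rintro ⟨p, hp, θ, h, hθ⟩
      exact ⟨deckT p, (hK.deck p).2 hp, θ, h.deckT hK.deck, hθ⟩
  have hFN : ∀ z ∈ N, T.F z ∈ N := fun z hz => T.topComp_forward hinv hz
  have hclO : ∀ q ∈ closure O, T.F.symm q ∈ N → T.F.symm q ∈ O := by
    intro q hq hqN
    have hqN' : q ∈ N := by simpa using hFN _ hqN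
    obtain ⟨p, hp, θ, h, hθ⟩ : ∃ p ∈ K, ∃ θ, HasAng K p q θ ∧ 3 * Real.pi / 2 ≤ θ := by
      by_contra! hcon
      have := eventually_angle_lt hK hqN' hcon
      obtain ⟨q', hq', p, hp, θ, h, hθ⟩ := mem_closure_iff_nhds.1 hq _ this
      exact absurd (hq' p hp θ h) (not_lt.2 hθ.le)
    obtain ⟨θ₀, h1, h2⟩ := T.angle_symm_gt hK hinv hp hqN h hθ
    exact ⟨_, hinv p hp, θ₀, h1, h2⟩
  let W : Set StripA := T.F.symm ⁻¹' O \ closure O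
  have hW : W = ∅ := by
    by_contra hne
    obtain ⟨k, hk, w, hw, hkw⟩ := T.nw W ((hOopen.preimage T.F.symm.continuous).sdiff
      isClosed_closure) (nonempty_iff_ne_empty.2 hne) (fun z => and_congr
        (by rw [mem_preimage, T.deck_symm]; exact hOdeck _) (not_congr (hOdeck.closure z)))
    have hwN : ∀ j, T.F^[j] (T.F.symm w) ∈ N := by
      intro j
      induction j with
      | zero => exact hON hw.1
      | succ j ih => rw [Function.iterate_succ_apply']; exact hFN _ ih
    have hback : ∀ j, T.F^[j + 1] (T.F.symm w) ∈ O → T.F^[j] (T.F.symm w) ∈ O := by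
      intro j hj
      have := hclO _ (subset_closure hj) (by
        rw [Function.iterate_succ_apply', T.F.symm_apply_apply]; exact hwN j)
      rwa [Function.iterate_succ_apply', T.F.symm_apply_apply] at this
    have hdesc : ∀ j, T.F^[j + 1] (T.F.symm w) ∈ O → T.F^[1] (T.F.symm w) ∈ O := by
      intro j
      induction j with
      | zero => exact id
      | succ j ih => exact fun h => ih (hback _ h)
    obtain ⟨j, rfl⟩ : ∃ j, k = j + 1 := ⟨k - 1, by omega⟩
    have h1 : T.F^[j + 1] (T.F.symm w) ∈ O := by
      have := hkw.1
      rw [Function.iterate_succ_apply', mem_preimage, T.F.symm_apply_apply] at this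
      rw [Function.iterate_succ_apply, T.F.apply_symm_apply]
      exact this
    have h2 := hdesc j h1
    simp only [Function.iterate_one, T.F.apply_symm_apply] at h2
    exact hw.2 (subset_closure h2)
  have hO : O = ∅ := by
    by_contra hne
    obtain ⟨q, hq⟩ := nonempty_iff_ne_empty.2 hne
    obtain ⟨c, hc, γ, hγ⟩ := hON hq
    have hγN : ∀ t, γ t ∈ N := by
      intro t
      refine ⟨c, hc, joinedIn_of_path (fun s => γ (s * t)) (by fun_prop) (by simp) (by simp)
        fun s => hγ _⟩
    have hcl : γ ⁻¹' O = (fun t => T.F (γ t)) ⁻¹' closure O := by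
      ext t
      simp only [mem_preimage]
      constructor
      · intro h
        by_contra hcon
        have : T.F (γ t) ∈ W := ⟨by simpa using h, hcon⟩
        rw [hW] at this
        exact this
      · intro h
        simpa using hclO _ h (by simpa using hγN t)
    have hclopen : IsClopen (γ ⁻¹' O) :=
      ⟨hcl ▸ isClosed_closure.preimage (T.F.continuous.comp γ.continuous),
        hOopen.preimage γ.continuous⟩
    have h0 : (0 : unitInterval) ∈ γ ⁻¹' O := by
      rcases isClopen_iff.1 hclopen with h | h
      · have h1 : (1 : unitInterval) ∈ γ ⁻¹' O := by simpa using hq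
        rw [h] at h1
        exact absurd h1 (notMem_empty _)
      · rw [h]; trivial
    rw [mem_preimage, γ.source] at h0
    obtain ⟨p, hp, θ, h, hθ⟩ := h0
    obtain ⟨θ', hθ', h'⟩ := HasAng.of_top hp (by simpa using hγ 0) hc
    rw [h.unique hp hK.deck hK.conn h'] at hθ
    linarith [hθ'.2, Real.pi_pos]
  by_contra! hcon
  have : q ∈ O := ⟨p, hp, θ, h, hcon⟩
  rw [hO] at this
  exact this

lemma angle_lt {K : Set StripA} (hK : LowerSide K) (hinv : ∀ z ∈ K, T.F.symm z ∈ K)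
    {p q : StripA} (hp : p ∈ K) (hq : T.F.symm q ∈ TopComp K) {θ : ℝ} (h : HasAng K p q θ) :
    θ < 3 * Real.pi / 2 := by
  by_contra! hcon
  obtain ⟨θ₀, h1, h2⟩ := T.angle_symm_gt hK hinv hp hq h hcon
  exact absurd (T.angle_le hK hinv (hinv p hp) h1) (not_le.2 h2)

end TwistLift

/-! ### Invariant sets below a graph -/

namespace TwistLift

variable (T : TwistLift)

lemma eventually_mem_right {D : Set StripA} (hdown : ∀ z w : StripA, z.1 = w.1 → z.2 ≤ w.2 →
    w ∈ D → z ∈ D) (hinv : ∀ z, T.F z ∈ D ↔ z ∈ D) {x : ℝ} {y₀ y y₁ : ↥(Icc (0:ℝ) 1)}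
    (h0 : y₀ < y) (h1 : y < y₁) (hD : (x, y₁) ∈ D) :
    ∀ᶠ z in 𝓝 ((x, y) : StripA), x < z.1 → z ∈ D := by
  have e1 := T.twist (x, y₀) (x, y) rfl h0
  have e2 := T.twist (x, y) (x, y₁) rfl h1
  have hF : Continuous fun z => (T.F z).1 := by fun_prop
  filter_upwards [(hF.tendsto _).eventually (lt_mem_nhds e1),
    (hF.tendsto _).eventually (gt_mem_nhds e2)] with z hz1 hz2 hxz
  have hc : Continuous fun y' : ↥(Icc (0:ℝ) 1) => (T.F (x, y')).1 := by fun_prop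
  obtain ⟨y', hy', hy''⟩ := intermediate_value_Icc (h0.trans h1).le hc.continuousOn
    ⟨hz1.le, hz2.le⟩
  have hmem : (x, y') ∈ D := hdown _ (x, y₁) rfl hy'.2 hD
  rw [← hinv] at hmem ⊢
  refine hdown _ _ hy''.symm ?_ hmem
  by_contra! hcon
  have := T.itwist _ _ hy'' hcon
  simp only [Homeomorph.symm_apply_apply] at this
  exact absurd this (not_lt.2 hxz.le)

lemma mem_interior_of_lt {D : Set StripA} (hdown : ∀ z w : StripA, z.1 = w.1 → z.2 ≤ w.2 →
    w ∈ D → z ∈ D) (hinv : ∀ z, T.F z ∈ D ↔ z ∈ D) {x : ℝ} {y₀ y y₁ : ↥(Icc (0:ℝ) 1)}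
    (h0 : y₀ < y) (h1 : y < y₁) (hD : (x, y₁) ∈ D) : D ∈ 𝓝 ((x, y) : StripA) := by
  have hr := T.eventually_mem_right hdown hinv h0 h1 hD
  have hl := T.mirrorX.eventually_mem_right (D := reflX ⁻¹' D) (x := -x)
    (fun z w h h' hw => hdown (reflX z) (reflX w) (by simp [h]) h' hw)
    (fun z => by
      change reflX (reflX (T.F.symm (reflX z))) ∈ D ↔ reflX z ∈ D
      rw [reflX_reflX, ← hinv, T.F.apply_symm_apply]) h0 h1 (by simpa using hD)
  have ht : Tendsto reflX (𝓝 ((x, y) : StripA)) (𝓝 (-x, y)) := reflX.continuous.tendsto (x, y)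
  have hm : ∀ᶠ z : StripA in 𝓝 (x, y), z.2 < y₁ :=
    (continuous_snd.tendsto (x, y)).eventually (gt_mem_nhds h1)
  filter_upwards [hr, ht.eventually hl, hm] with z hz1 hz2 hz3
  rcases lt_trichotomy z.1 x with h | h | h
  · have := hz2 (by simpa using h)
    rwa [mem_preimage, reflX_reflX] at this
  · exact hdown z (x, y₁) h hz3.le hD
  · exact hz1 h

/-- A closed invariant region below a function is trivial. -/
lemma downset_trivial {D : Set StripA} (hcl : IsClosed D) (hdeck : DeckInv D)
    (hdown : ∀ z w : StripA, z.1 = w.1 → z.2 ≤ w.2 → w ∈ D → z ∈ D)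
    (hinv : ∀ z, T.F z ∈ D ↔ z ∈ D) (hbot : ∀ z : StripA, z.2 = 0 → z ∈ D) :
    D = univ ∨ ∀ z ∈ D, z.2 = 0 := by
  let b : ℝ → ↥(Icc (0:ℝ) 1) := fun x => sSup {y | (x, y) ∈ D}
  have hb : ∀ z : StripA, z ∈ D ↔ z.2 ≤ b z.1 := by
    intro z
    constructor
    · intro hz
      exact le_sSup hz
    · intro hz
      have hc : IsCompact {y | ((z.1, y) : StripA) ∈ D} :=
        (hcl.preimage (by fun_prop : Continuous fun y => ((z.1, y) : StripA))).isCompact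
      have := hc.sSup_mem ⟨0, hbot _ rfl⟩
      exact hdown z (z.1, b z.1) rfl hz this
  have hint : ∀ z : StripA, z.2 < b z.1 → D ∈ 𝓝 z := by
    intro z hz
    obtain ⟨c, hc1, hc2⟩ := exists_between hz
    obtain ⟨d, hd1, hd2⟩ := exists_between hc2
    have hcD : D ∈ 𝓝 ((z.1, c) : StripA) := T.mem_interior_of_lt hdown hinv hc1
      (hd1.trans hd2) ((hb (z.1, b z.1)).2 le_rfl)
    have ht : Tendsto (fun w : StripA => ((w.1, c) : StripA)) (𝓝 z) (𝓝 (z.1, c)) :=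
      (by fun_prop : Continuous fun w : StripA => ((w.1, c) : StripA)).tendsto z
    filter_upwards [ht.eventually hcD,
      (continuous_snd.tendsto z).eventually (gt_mem_nhds hc1)] with w hw1 hw2
    exact hdown w (w.1, c) rfl hw2.le hw1
  have hbc : Continuous b := by
    rw [continuous_iff_continuousAt]
    intro x
    rw [ContinuousAt, tendsto_order]
    constructor
    · intro c hc
      obtain ⟨d, hd1, hd2⟩ := exists_between hc
      have ht : Tendsto (fun w : ℝ => ((w, d) : StripA)) (𝓝 x) (𝓝 (x, d)) :=
        (by fun_prop : Continuous fun w : ℝ => ((w, d) : StripA)).tendsto x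
      filter_upwards [ht.eventually (hint (x, d) hd2)] with w hw
      exact hd1.trans_le ((hb (w, d)).1 hw)
    · intro c hc
      have ht : Tendsto (fun w : ℝ => ((w, c) : StripA)) (𝓝 x) (𝓝 (x, c)) :=
        (by fun_prop : Continuous fun w : ℝ => ((w, c) : StripA)).tendsto x
      have h2 : (x, c) ∉ D := fun h => absurd ((hb (x, c)).1 h) (not_le.2 hc)
      filter_upwards [ht.eventually (hcl.isOpen_compl.mem_nhds h2)] with w hw
      exact not_le.1 fun h => hw ((hb (w, c)).2 h)
  have hgr : ∀ z : StripA, z.2 = b z.1 ↔ z ∈ D ∧ (D ∉ 𝓝 z ∨ z.2 = 1) := by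
    intro z
    constructor
    · intro hz
      refine ⟨(hb z).2 hz.le, ?_⟩
      by_contra! hcon
      have hz1 : z.2 < 1 := lt_of_le_of_ne unitInterval.le_one' hcon.2
      have hc : Continuous fun c : ↥(Icc (0:ℝ) 1) => ((z.1, c) : StripA) := by fun_prop
      have h1 : ∀ᶠ c in 𝓝 z.2, ((z.1, c) : StripA) ∈ D := (hc.tendsto z.2).eventually hcon.1
      obtain ⟨u, hu, hu'⟩ := exists_Ico_subset_of_mem_nhds h1 ⟨1, hz1⟩
      obtain ⟨c, hc1, hc2⟩ := exists_between hu
      have := (hb (z.1, c)).1 (hu' ⟨hc1.le, hc2⟩)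
      rw [← hz] at this
      exact absurd this (not_le.2 hc1)
    · rintro ⟨h1, h2⟩
      have h3 := (hb z).1 h1
      rcases h2 with h2 | h2
      · exact h3.antisymm (not_lt.1 fun h => h2 (hint z h))
      · exact h3.antisymm (h2 ▸ unitInterval.le_one')
  have hpre : T.F ⁻¹' D = D := by ext z; exact hinv z
  have hg := T.graph b hbc (fun x => by
    have : ∀ y, ((x + 1, y) : StripA) ∈ D ↔ ((x, y) : StripA) ∈ D := fun y => hdeck (x, y)
    simp only [b, this]) (by
    intro z
    rw [hgr, hgr, hinv, T.top]
    have : D ∈ 𝓝 (T.F z) ↔ D ∈ 𝓝 z := by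
      conv_rhs => rw [← hpre]
      rw [← T.F.map_nhds_eq, mem_map]
    rw [this])
  rcases hg with h | h
  · right
    intro z hz
    have := (hb z).1 hz
    rw [h] at this
    exact le_antisymm this unitInterval.nonneg'
  · left
    refine eq_univ_of_forall fun z => (hb z).2 ?_
    rw [h]
    exact unitInterval.le_one'

end TwistLift

lemma im_pos_of_angle {v : ℂ} {θ : ℝ} (hv : v ≠ 0)
    (h : (θ : Real.Angle) = (v.arg : Real.Angle)) (hre : v.re = 0)
    (h1 : -(Real.pi / 2) < θ) (h2 : θ < 3 * Real.pi / 2) : 0 < v.im := by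
  obtain ⟨hr, hi⟩ := re_im_of_coe_eq_arg h
  have hn : 0 < ‖v‖ := norm_pos_iff.2 hv
  have hc : Real.cos θ = 0 := by
    rw [hre] at hr
    rcases mul_eq_zero.1 hr.symm with h | h
    · linarith
    · exact h
  have hs : Real.sin (θ - Real.pi / 2) = 0 := by rw [Real.sin_sub_pi_div_two, hc, neg_zero]
  have := (Real.sin_eq_zero_iff_of_lt_of_lt (by linarith) (by linarith)).1 hs
  rw [hi, show θ = Real.pi / 2 by linarith, Real.sin_pi_div_two]
  linarith

lemma DeckInv.compl {K : Set StripA} (h : DeckInv K) : DeckInv Kᶜ :=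
  fun z => not_congr (h z)

lemma LowerSide.reflX {K : Set StripA} (hK : LowerSide K) : LowerSide (reflX ⁻¹' K) where
  closed := hK.closed.preimage _root_.reflX.continuous
  deck := hK.deck.reflX
  conn := by
    intro W hW hdW hKW p hp
    obtain ⟨c, hc, γ, hγ⟩ := hK.conn (_root_.reflX ⁻¹' W)
      (hW.preimage _root_.reflX.continuous) hdW.reflX
      (fun z hz => hKW (by rwa [mem_preimage, reflX_reflX])) _ hp
    refine ⟨_root_.reflX c, hc, joinedIn_of_path (fun t => _root_.reflX (γ t))
      (_root_.reflX.continuous.comp γ.continuous) (by simp only [γ.source]) ?_ hγ⟩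
    simp only [γ.target]
    exact reflX_reflX p

namespace TwistLift

variable (T : TwistLift)

lemma neg_lt_angle {K : Set StripA} (hK : LowerSide K) (hinv : ∀ z, T.F z ∈ K ↔ z ∈ K)
    {p q : StripA} (hp : p ∈ K) (hq : T.F q ∈ TopComp K) {θ : ℝ} (h : HasAng K p q θ) :
    -(Real.pi / 2) < θ := by
  have hq' : T.mirrorX.F.symm (reflX q) ∈ TopComp (reflX ⁻¹' K) := by
    change reflX (T.F (reflX (reflX q))) ∈ _
    rw [reflX_reflX]
    obtain ⟨θ', h'⟩ := HasAng.exists hp hq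
    exact h'.reflX.mem_topComp
  have := T.mirrorX.angle_lt hK.reflX (fun z hz => (hinv _).2 (by
    change reflX (reflX (T.F (reflX z))) ∈ K
    rw [reflX_reflX]
    exact (hinv _).2 hz) |> fun h' => (hinv _).1 h') (by simpa using hp) hq' h.reflX
  linarith

/-- A closed invariant set strictly containing the bottom line and linked to it contains the
top line. -/
lemma top_subset {K : Set StripA} (hK : LowerSide K) (hinv : ∀ z, T.F z ∈ K ↔ z ∈ K)
    (hbot : ∀ z : StripA, z.2 = 0 → z ∈ K) (hne : ∃ p ∈ K, p.2 ≠ 0) (c : StripA)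
    (hc : c.2 = 1) : c ∈ K := by
  by_contra hcK
  have hinv' : ∀ z ∈ K, T.F.symm z ∈ K := fun z hz => by rw [← hinv]; simpa using hz
  have hNinv : ∀ z, T.F z ∈ TopComp K ↔ z ∈ TopComp K := by
    intro z
    refine ⟨?_, T.topComp_forward hinv'⟩
    rintro ⟨c, hc, γ, hγ⟩
    refine ⟨T.F.symm c, (T.top_symm c).2 hc, joinedIn_of_path (fun t => T.F.symm (γ t))
      (T.F.symm.continuous.comp γ.continuous) (by simp) (by simp) fun t ht => hγ t ?_⟩
    rw [← hinv] at ht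
    simpa using ht
  have horder : ∀ p ∈ K, ∀ q ∈ TopComp K, p.1 = q.1 → p.2 < q.2 := by
    intro p hp q hq hpq
    obtain ⟨θ, h⟩ := HasAng.exists hp hq
    have h1 := T.angle_lt hK hinv' hp (by rw [← hNinv]; simpa using hq) h
    have h2 := T.neg_lt_angle hK hinv hp ((hNinv q).2 hq) h
    have := im_pos_of_angle (dv_ne_zero h.coe_eq.1) h.coe_eq.2 (by simp [hpq]) h2 h1
    simpa using this
  have hup : ∀ z w : StripA, z.1 = w.1 → z.2 ≤ w.2 → z ∈ TopComp K → w ∈ TopComp K := by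
    rintro z w h1 h2 ⟨d, hd, hj⟩
    refine ⟨d, hd, hj.trans (joinedIn_of_path (fun t => seg z w t) (by fun_prop) (by simp)
      (by simp) fun t ht => ?_)⟩
    have h3 : (seg z w t).1 = z.1 := by simp only [seg, h1]; ring
    have h4 := horder _ ht z ⟨d, hd, hj⟩ h3
    have h5 : (z.2 : ℝ) ≤ w.2 := h2
    have h6 : (1 - (t : ℝ)) * z.2 + t * w.2 < (z.2 : ℝ) := h4
    nlinarith [t.2.1, mul_nonneg t.2.1 (sub_nonneg.2 h5)]
  have hcN : c ∈ TopComp K := ⟨c, hc, JoinedIn.refl hcK⟩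
  obtain ⟨p, hp, hp0⟩ := hne
  rcases T.downset_trivial (TopComp.isOpen hK.closed).isClosed_compl hK.deck.topComp.compl
    (fun z w h1 h2 hw hz => hw (hup z w h1 h2 hz)) (fun z => not_congr (hNinv z))
    (fun z hz hzN => TopComp.subset_compl K hzN (hbot z hz)) with h | h
  · have : c ∈ (TopComp K)ᶜ := by rw [h]; trivial
    exact this hcN
  · exact hp0 (h p fun hpN => TopComp.subset_compl K hpN hp)

end TwistLift

/-! ### The lift of a positive twist map -/

lemma strictMono_and_surjective_of_deg_one {g : ℝ → ℝ} (hg : Continuous g)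
    (hi : Function.Injective g) (hp : ∀ x, g (x + 1) = g x + 1) :
    StrictMono g ∧ Function.Surjective g := by
  constructor
  · rcases hg.strictMono_of_inj hi with h | h
    · exact h
    · have h1 := h (zero_lt_one' ℝ)
      have h2 := hp 0
      rw [zero_add] at h2
      linarith
  · have hn : ∀ n : ℕ, g n = g 0 + n ∧ g (-n) = g 0 - n := by
      intro n
      induction n with
      | zero => simp
      | succ n ih =>
        refine ⟨?_, ?_⟩
        · push_cast
          rw [hp, ih.1]
          ring
        · have := hp (-((n : ℝ) + 1))
          rw [show -((n : ℝ) + 1) + 1 = -n by ring, ih.2] at this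
          push_cast
          linarith
    intro y
    obtain ⟨n, hn'⟩ := exists_nat_ge (|y - g 0|)
    obtain ⟨x, -, hx⟩ := intermediate_value_Icc (show (-(n : ℝ)) ≤ n by
      linarith [n.cast_nonneg (α := ℝ)]) hg.continuousOn (show y ∈ Icc (g (-n)) (g n) by
        rw [(hn n).1, (hn n).2]
        have := abs_le.1 hn'
        constructor <;> linarith)
    exact ⟨x, hx⟩

/-- A diffeomorphism of the strip maps the top line into the boundary. -/
lemma snd_eq_zero_or_one_of_hasFDerivWithinAt (e : StripA ≃ₜ StripA) {F G : ℝ × ℝ → ℝ × ℝ}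
    {F' G' : ℝ × ℝ → (ℝ × ℝ) →L[ℝ] (ℝ × ℝ)}
    (hF : ∀ z : StripA, F (z.1, (z.2 : ℝ)) = ((e z).1, ((e z).2 : ℝ)))
    (hG : ∀ z : StripA, G (z.1, (z.2 : ℝ)) = ((e.symm z).1, ((e.symm z).2 : ℝ)))
    (hF' : ∀ z ∈ stripS, HasFDerivWithinAt F (F' z) stripS z)
    (hG' : ∀ z ∈ stripS, HasFDerivWithinAt G (G' z) stripS z)
    (hG'c : ContinuousOn G' stripS) {z : StripA} (hz : z.2 = 1) :
    (e z).2 = 0 ∨ (e z).2 = 1 := by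
  by_contra! h
  set w : ℝ × ℝ := ((e z).1, ((e z).2 : ℝ)) with hw
  have h0 : 0 < w.2 := lt_of_le_of_ne (e z).2.2.1 fun h' => h.1 (Subtype.ext h'.symm)
  have h1 : w.2 < 1 := lt_of_le_of_ne (e z).2.2.2 fun h' => h.2 (Subtype.ext h')
  have hint : ∀ v : ℝ × ℝ, 0 < v.2 → v.2 < 1 → stripS ∈ 𝓝 v := fun v hv0 hv1 =>
    continuous_snd.continuousAt.preimage_mem_nhds (Icc_mem_nhds hv0 hv1)
  have hGs : ∀ v ∈ stripS, G v ∈ stripS := fun v hv => by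
    have := hG (v.1, ⟨v.2, hv⟩)
    rw [show G v = _ from this]
    exact (e.symm (v.1, ⟨v.2, hv⟩)).2.2
  have hFG : ∀ v ∈ stripS, F (G v) = v := fun v hv => by
    have := hG (v.1, ⟨v.2, hv⟩)
    rw [show G v = _ from this, hF]
    simp
  have hGw : G w = (z.1, (z.2 : ℝ)) := by rw [hw, hG]; simp
  have hwS : w ∈ stripS := (e z).2.2
  have hcomp : HasFDerivWithinAt (F ∘ G) ((F' (G w)).comp (G' w)) stripS w :=
    (hF' _ (hGs w hwS)).comp w (hG' w hwS) hGs
  have hid : HasFDerivAt (F ∘ G) (ContinuousLinearMap.id ℝ (ℝ × ℝ)) w :=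
    (hasFDerivAt_id w).congr_of_eventuallyEq <| by
      filter_upwards [hint w h0 h1] with v hv using hFG v hv
  have heq := (hcomp.hasFDerivAt (hint w h0 h1)).unique hid
  have hinj : Function.Injective (G' w) := fun a b hab => by
    have ha := congrArg (fun L : (ℝ × ℝ) →L[ℝ] (ℝ × ℝ) => L a) heq
    have hb := congrArg (fun L : (ℝ × ℝ) →L[ℝ] (ℝ × ℝ) => L b) heq
    simp only [ContinuousLinearMap.comp_apply, ContinuousLinearMap.id_apply] at ha hb
    rw [← ha, ← hb, hab]
  have hrange : (G' w).range = ⊤ :=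
    LinearMap.range_eq_top.2 ((LinearMap.injective_iff_surjective
      (f := (G' w : (ℝ × ℝ) →ₗ[ℝ] (ℝ × ℝ)))).1 hinj)
  have hstrict : HasStrictFDerivAt G (G' w) w := by
    refine hasStrictFDerivAt_of_hasFDerivAt_of_continuousAt ?_ (hG'c.continuousAt (hint w h0 h1))
    have : ∀ᶠ v in 𝓝 w, v.2 ∈ Ioo (0:ℝ) 1 :=
      continuous_snd.continuousAt.preimage_mem_nhds (Ioo_mem_nhds h0 h1)
    filter_upwards [this] with v hv
    exact (hG' v ⟨hv.1.le, hv.2.le⟩).hasFDerivAt (hint v hv.1 hv.2)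
  have hnhds := hstrict.map_nhds_eq_of_surj hrange
  have hS : stripS ∈ 𝓝 (G w) := by
    rw [← hnhds]
    exact mem_of_superset (image_mem_map (hint w h0 h1)) (by rintro _ ⟨v, hv, rfl⟩; exact hGs v hv)
  have hcont : Tendsto (fun t : ℝ => ((z.1, 1 + t) : ℝ × ℝ)) (𝓝[>] 0) (𝓝 (G w)) := by
    have : Continuous (fun t : ℝ => ((z.1, 1 + t) : ℝ × ℝ)) := by fun_prop
    have h2 := this.tendsto 0
    rw [hGw, hz]
    simp only [add_zero] at h2
    exact h2.mono_left nhdsWithin_le_nhds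
  obtain ⟨t, ht, ht0⟩ := ((hcont.eventually hS).and self_mem_nhdsWithin).exists
  have := ht.2
  have : 0 < t := ht0
  linarith

lemma AnnulusHomeo.iter_natCast (h : AnnulusHomeo) (k : ℕ) : h.iter (k : ℤ) = h.toFun^[k] := by
  funext z
  rw [AnnulusHomeo.iter, zpow_natCast, ← Equiv.Perm.iterate_eq_pow]
  rfl

lemma AnnulusHomeo.semiconj (h : AnnulusHomeo) : Function.Semiconj annProj h.lift h.toFun :=
  h.lift_proj

lemma AnnulusHomeo.lift_zpow_proj (h : AnnulusHomeo) (k : ℕ) (z : StripA) :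
    annProj (h.lift^[k] z) = h.iter (k : ℤ) (annProj z) := by
  rw [h.iter_natCast]
  exact (h.semiconj.iterate_right k).eq z

lemma isOpenMap_annProj : IsOpenMap annProj :=
  IsOpenMap.prodMap (QuotientAddGroup.isOpenMap_coe (N := AddSubgroup.zmultiples (1 : ℝ)))
    IsOpenMap.id

lemma annProj_surjective : Function.Surjective annProj := by
  rintro ⟨θ, y⟩
  obtain ⟨x, rfl⟩ := QuotientAddGroup.mk_surjective θ
  exact ⟨(x, y), rfl⟩

lemma not_nullhomotopic_of_fst_eq (γ : C(𝕋, Ann)) (h : ∀ θ, (γ θ).1 = θ) :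
    ¬ γ.Nullhomotopic := by
  intro hγ
  have h1 := hγ.comp_right (⟨Prod.fst, continuous_fst⟩ : C(Ann, 𝕋))
  have h2 : (⟨Prod.fst, continuous_fst⟩ : C(Ann, 𝕋)).comp γ = ContinuousMap.id 𝕋 := by
    ext θ
    exact h θ
  rw [h2] at h1
  have : ContractibleSpace 𝕋 := (contractible_iff_id_nullhomotopic 𝕋).2 h1
  have e1 : ((1 : ℝ) : 𝕋) = ((0 : ℝ) : 𝕋) := by
    simp
  have cov := AddCircle.isCoveringMap_coe (1 : ℝ)
  let p₁ : Path ((0 : ℝ) : 𝕋) ((0 : ℝ) : 𝕋) :=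
    { toFun := fun t => ((t : ℝ) : 𝕋)
      continuous_toFun := (AddCircle.continuous_mk' (1 : ℝ)).comp continuous_subtype_val
      source' := by simp
      target' := by simp }
  have hh := cov.liftPath_apply_one_eq_of_homotopicRel
    (SimplyConnectedSpace.paths_homotopic p₁ (Path.refl _)) 0 p₁.source (Path.refl _).source
  have l1 : (⟨fun t : unitInterval => (t : ℝ), continuous_subtype_val⟩ : C(unitInterval, ℝ)) =
      cov.liftPath p₁.toContinuousMap 0 p₁.source :=
    (cov.eq_liftPath_iff' (γ := p₁.toContinuousMap) (γ_0 := p₁.source)).2 ⟨rfl, rfl⟩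
  have l2 : (ContinuousMap.const unitInterval (0 : ℝ)) =
      cov.liftPath (Path.refl ((0 : ℝ) : 𝕋)).toContinuousMap 0 (Path.refl _).source :=
    (cov.eq_liftPath_iff' (γ_0 := (Path.refl _).source)).2 ⟨rfl, rfl⟩
  rw [← l1, ← l2] at hh
  simp at hh

lemma NoInvariantTransverseLoop.graph {h : AnnulusHomeo} (hN : NoInvariantTransverseLoop h)
    (a : ℝ → ↥(Icc (0:ℝ) 1)) (ha : Continuous a) (hp : ∀ x, a (x + 1) = a x)
    (hi : ∀ z : StripA, (h.lift z).2 = a (h.lift z).1 ↔ z.2 = a z.1) :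
    (∀ x, a x = 0) ∨ ∀ x, a x = 1 := by
  have hper : Function.Periodic a 1 := hp
  have hb : Continuous (hper.lift : 𝕋 → ↥(Icc (0:ℝ) 1)) := ha.quotient_liftOn' _
  let γ : C(𝕋, Ann) := ⟨fun θ => (θ, hper.lift θ), by fun_prop⟩
  have hmem : ∀ z : StripA, annProj z ∈ range γ ↔ z.2 = a z.1 := by
    intro z
    constructor
    · rintro ⟨θ, hθ⟩
      have h1 : θ = (z.1 : 𝕋) := congrArg Prod.fst hθ
      have h2 : hper.lift θ = z.2 := congrArg Prod.snd hθ
      rw [← h2, h1]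
      rfl
    · intro hz
      exact ⟨(z.1 : 𝕋), Prod.ext rfl hz.symm⟩
  have hinv : h.toFun '' range γ = range γ := by
    ext w
    obtain ⟨z, rfl⟩ := annProj_surjective (h.toFun.symm w)
      |>.imp fun z hz => (show h.toFun (annProj z) = w by rw [hz]; simp)
    rw [h.toFun.injective.mem_set_image, hmem, ← h.lift_proj, hmem, hi]
  rcases hN (range γ) ⟨γ, fun x y hxy => congrArg Prod.fst hxy,
      not_nullhomotopic_of_fst_eq γ fun _ => rfl, rfl⟩ (fun x => ⟨γ x, ⟨⟨x, rfl⟩, rfl⟩, by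
        rintro _ ⟨⟨y, rfl⟩, hy⟩
        exact congrArg γ hy⟩) hinv with h0 | h1
  · refine Or.inl fun x => ?_
    have : annProj (x, a x) ∈ C0 := by rw [← h0, hmem]
    exact Subtype.ext this
  · refine Or.inr fun x => ?_
    have : annProj (x, a x) ∈ C1 := by rw [← h1, hmem]
    exact Subtype.ext this

lemma NonWandering.strip {h : AnnulusHomeo} (hnw : NonWandering h) (W : Set StripA)
    (hW : IsOpen W) (hne : W.Nonempty) (hd : DeckInv W) :
    ∃ k : ℕ, 0 < k ∧ ∃ z ∈ W, h.lift^[k] z ∈ W := by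
  obtain ⟨k, hk, _, ⟨_, ⟨z, hz, rfl⟩, rfl⟩, w, hw, hwz⟩ :=
    hnw (annProj '' W) (isOpenMap_annProj W hW) (hne.image _)
  rw [← h.lift_zpow_proj] at hwz
  exact ⟨k, hk, z, hz, hd.of_annProj_eq hwz hw⟩

namespace PositiveTwistMap

variable (f : PositiveTwistMap)

lemma lift_twist (z w : StripA) (h1 : z.1 = w.1) (h2 : z.2 < w.2) :
    (f.lift z).1 < (f.lift w).1 := by
  have hmono : StrictMonoOn (fun t : ℝ => (f.F (z.1, t)).1) (Icc 0 1) := by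
    have hder : ∀ t ∈ Icc (0:ℝ) 1, HasDerivWithinAt (fun t : ℝ => (f.F (z.1, t)).1)
        ((f.F' (z.1, t) (0, 1)).1) (Icc 0 1) t := by
      intro t ht
      have hl : HasDerivWithinAt (fun t : ℝ => ((z.1, t) : ℝ × ℝ)) (0, 1) (Icc 0 1) t :=
        (hasDerivWithinAt_const t _ z.1).prodMk (hasDerivWithinAt_id t _)
      have := (f.F_hasDeriv (z.1, t) ht).comp_hasDerivWithinAt t hl (fun s hs => hs)
      exact (hasFDerivAt_fst.comp_hasDerivWithinAt t this)
    refine strictMonoOn_of_deriv_pos (convex_Icc 0 1)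
      (fun t ht => (hder t ht).continuousWithinAt) fun t ht => ?_
    rw [interior_Icc] at ht
    rw [((hder t ⟨ht.1.le, ht.2.le⟩).hasDerivAt (Icc_mem_nhds ht.1 ht.2)).deriv]
    exact f.twist_pos _ ⟨ht.1.le, ht.2.le⟩
  have := hmono z.2.2 w.2.2 h2
  simp only [f.F_lift z] at this
  rw [h1, f.F_lift w] at this
  exact this

lemma lift_bot_deg_one : StrictMono (fun x => (f.lift (x, 0)).1) ∧
    Function.Surjective (fun x => (f.lift (x, 0)).1) := by
  refine strictMono_and_surjective_of_deg_one (by fun_prop) (fun x y hxy => ?_) fun x =>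
    congrArg Prod.fst (f.lift_deck (x, 0))
  have : f.lift (x, 0) = f.lift (y, 0) := Prod.ext hxy <| Subtype.ext <| by
    rw [f.lift_bd0 (x, 0) rfl, f.lift_bd0 (y, 0) rfl]
  exact congrArg Prod.fst (f.lift.injective this)

lemma lift_bot (z : StripA) : (f.lift z).2 = 0 ↔ z.2 = 0 := by
  refine ⟨fun h => ?_, fun h => Subtype.ext (f.lift_bd0 z (congrArg _ h))⟩
  obtain ⟨x, hx⟩ := f.lift_bot_deg_one.2 (f.lift z).1
  have : f.lift (x, 0) = f.lift z := Prod.ext hx <| by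
    rw [h]
    exact Subtype.ext (f.lift_bd0 (x, 0) rfl)
  rw [← f.lift.injective this]

lemma lift_top (z : StripA) : (f.lift z).2 = 1 ↔ z.2 = 1 := by
  constructor
  · intro h
    have := snd_eq_zero_or_one_of_hasFDerivWithinAt f.lift.symm f.G_lift f.F_lift f.G_hasDeriv
      f.F_hasDeriv f.F'_cont h
    rw [f.lift.symm_apply_apply] at this
    refine this.resolve_left fun h0 => ?_
    rw [← f.lift_bot, h] at h0
    exact one_ne_zero h0
  · intro h
    refine (snd_eq_zero_or_one_of_hasFDerivWithinAt f.lift f.F_lift f.G_lift f.F_hasDeriv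
      f.G_hasDeriv f.G'_cont h).resolve_left fun h0 => ?_
    rw [f.lift_bot, h] at h0
    exact one_ne_zero h0

lemma lift_top_strictMono : StrictMono (fun x => (f.lift (x, 1)).1) := by
  refine (strictMono_and_surjective_of_deg_one (by fun_prop) (fun x y hxy => ?_) fun x =>
    congrArg Prod.fst (f.lift_deck (x, 1))).1
  have : f.lift (x, 1) = f.lift (y, 1) := Prod.ext hxy <| by
    rw [(f.lift_top (x, 1)).2 rfl, (f.lift_top (y, 1)).2 rfl]
  exact congrArg Prod.fst (f.lift.injective this)

lemma lift_symm_twist (z w : StripA) (h1 : z.1 = w.1) (h2 : z.2 < w.2) :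
    (f.lift.symm w).1 < (f.lift.symm z).1 := by
  have hanti : StrictAnti (fun t : ↥(Icc (0:ℝ) 1) => (f.lift.symm (z.1, t)).1) := by
    refine Continuous.strictAnti_of_inj_boundedOrder (by fun_prop) ?_ ?_
    · by_contra! hlt
      set u := f.lift.symm (z.1, (⊤ : ↥(Icc (0:ℝ) 1))) with hu
      set v := f.lift.symm (z.1, (⊥ : ↥(Icc (0:ℝ) 1))) with hv
      have hu2 : u.2 = 1 := by
        rw [← f.lift_top, hu, f.lift.apply_symm_apply]
        rfl
      have hv2 : v.2 = 0 := by
        rw [← f.lift_bot, hv, f.lift.apply_symm_apply]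
        rfl
      have a1 := f.lift_twist v (v.1, 1) rfl (by rw [hv2]; exact zero_lt_one)
      have a2 := f.lift_top_strictMono hlt
      have a3 : ((u.1, 1) : StripA) = u := Prod.ext rfl hu2.symm
      simp only [a3] at a2
      rw [hv, f.lift.apply_symm_apply, ← hv] at a1
      rw [hu, f.lift.apply_symm_apply] at a2
      exact lt_asymm a1 a2
    · intro s t hst
      by_contra hne
      set u := f.lift.symm (z.1, s) with hu
      set v := f.lift.symm (z.1, t) with hv
      have hu' : (f.lift u).1 = z.1 := by rw [hu, f.lift.apply_symm_apply]
      have hv' : (f.lift v).1 = z.1 := by rw [hv, f.lift.apply_symm_apply]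
      rcases lt_trichotomy u.2 v.2 with h | h | h
      · have := f.lift_twist u v hst h
        rw [hu', hv'] at this
        exact this.false
      · have : u = v := Prod.ext hst h
        exact hne (congrArg Prod.snd (f.lift.symm.injective this))
      · have := f.lift_twist v u hst.symm h
        rw [hu', hv'] at this
        exact this.false
  have := hanti h2
  simp only at this
  rw [show ((z.1, w.2) : StripA) = w from Prod.ext h1 rfl] at this
  exact this

/-- The lift of a non wandering positive twist map without invariant transverse loop. -/
def twistLift (hnw : NonWandering f.toAnnulusHomeo)
    (hN : NoInvariantTransverseLoop f.toAnnulusHomeo) : TwistLift where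
  F := f.lift
  deck := f.lift_deck
  bot := f.lift_bot
  top := f.lift_top
  twist := f.lift_twist
  itwist := f.lift_symm_twist
  botmono := by
    rintro ⟨x, _⟩ ⟨y, _⟩ rfl rfl
    exact f.lift_bot_deg_one.1.lt_iff_lt
  topmono := by
    rintro ⟨x, _⟩ ⟨y, _⟩ rfl rfl
    exact f.lift_top_strictMono.lt_iff_lt
  nw := hnw.strip
  graph := hN.graph

end PositiveTwistMap

/-! ### Continua of the annulus -/

lemma mem_topComp_of_isPreconnected {Y : Set Ann} (hY : IsPreconnected Y) (h1 : C1 ⊆ Y)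
    {K : Set StripA} (hK : IsClosed K) (hd : DeckInv K) (hYK : ∀ z, annProj z ∈ Y → z ∉ K)
    {q : StripA} (hq : annProj q ∈ Y) : q ∈ TopComp K := by
  by_contra hqK
  have hO : IsOpen (Kᶜ \ TopComp K) := by
    rw [isOpen_iff_mem_nhds]
    rintro z ⟨hz, hzK⟩
    filter_upwards [eventually_joinedIn hK.isOpen_compl hz] with w hw
    exact ⟨hw.target_mem, fun ⟨c, hc, hj⟩ => hzK ⟨c, hc, hj.trans hw.symm⟩⟩
  have hcov : Y ⊆ annProj '' TopComp K ∪ annProj '' (Kᶜ \ TopComp K) := by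
    intro y hy
    obtain ⟨z, rfl⟩ := annProj_surjective y
    by_cases hz : z ∈ TopComp K
    · exact Or.inl ⟨z, hz, rfl⟩
    · exact Or.inr ⟨z, ⟨hYK z hy, hz⟩, rfl⟩
  have hc : annProj (0, 1) ∈ Y := h1 (show ((1 : ↥(Icc (0:ℝ) 1)) : ℝ) = 1 from rfl)
  obtain ⟨_, -, ⟨z, hz, rfl⟩, w, hw, hwz⟩ := hY _ _
    (isOpenMap_annProj _ (TopComp.isOpen hK)) (isOpenMap_annProj _ hO) hcov
    ⟨_, hc, (0, 1), ⟨(0, 1), rfl, JoinedIn.refl (hYK _ hc)⟩, rfl⟩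
    ⟨_, hq, q, ⟨hYK q hq, hqK⟩, rfl⟩
  exact hw.2 (hd.topComp.of_annProj_eq hwz.symm hz)

/-- The reflection `(θ, y) ↦ (θ, 1 - y)` of the annulus. -/
def flipY : Ann ≃ₜ Ann where
  toFun z := (z.1, unitInterval.symm z.2)
  invFun z := (z.1, unitInterval.symm z.2)
  left_inv z := by simp
  right_inv z := by simp
  continuous_toFun := by fun_prop
  continuous_invFun := by fun_prop

lemma flipY_flipY (z : Ann) : flipY (flipY z) = z := flipY.left_inv z

lemma annProj_reflY (z : StripA) : annProj (reflY z) = flipY (annProj z) := rfl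

lemma flipY_mem_C0 {z : Ann} : flipY z ∈ C0 ↔ z ∈ C1 := by
  change 1 - (z.2 : ℝ) = 0 ↔ (z.2 : ℝ) = 1
  rw [sub_eq_zero, eq_comm]

lemma flipY_mem_C1 {z : Ann} : flipY z ∈ C1 ↔ z ∈ C0 := by
  rw [← flipY_mem_C0, flipY_flipY]

lemma botConn_of_isPreconnected {X : Set Ann} (hX : IsPreconnected X) (h0 : C0 ⊆ X) :
    BotConn (annProj ⁻¹' X) := by
  intro W hW hd hXW p hp
  have hq : reflY p ∈ TopComp (reflY ⁻¹' Wᶜ) := by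
    refine mem_topComp_of_isPreconnected (Y := flipY ⁻¹' X)
      ((flipY.isPreconnected_preimage).2 hX) (fun z hz => h0 (flipY_mem_C0.2 hz))
      (hW.isClosed_compl.preimage reflY.continuous) hd.compl.reflY ?_ ?_
    · intro z hz hz'
      exact hz' (hXW hz)
    · rw [mem_preimage, annProj_reflY, flipY_flipY]
      exact hp
  obtain ⟨c, hc, γ, hγ⟩ := hq
  refine ⟨reflY c, by simp [hc], joinedIn_of_path (fun t => reflY (γ t))
    (reflY.continuous.comp γ.continuous) (by simp only [γ.source])
    (by simp only [γ.target]; exact reflY_reflY p) fun t => ?_⟩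
  exact not_not.1 (hγ t)

lemma deckInv_preimage (X : Set Ann) : DeckInv (annProj ⁻¹' X) := fun z => by
  rw [mem_preimage, annProj_deckT, mem_preimage]

lemma lowerSide_preimage {X : Set Ann} (hc : IsClosed X) (hX : IsPreconnected X)
    (h0 : C0 ⊆ X) : LowerSide (annProj ⁻¹' X) :=
  ⟨hc.preimage continuous_annProj, deckInv_preimage X, botConn_of_isPreconnected hX h0⟩

/-- A closed connected set containing `C₀` and backward invariant by `g`. -/
structure LowerCont (g : Ann ≃ₜ Ann) (X : Set Ann) : Prop where
  closed : IsClosed X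
  preconn : IsPreconnected X
  bot : C0 ⊆ X
  back : ∀ x, g x ∈ X → x ∈ X

lemma LowerCont.lowerSide {g : Ann ≃ₜ Ann} {X : Set Ann} (h : LowerCont g X) :
    LowerSide (annProj ⁻¹' X) :=
  lowerSide_preimage h.closed h.preconn h.bot

lemma LowerCont.preimage {g e : Ann ≃ₜ Ann} {X : Set Ann} (h : LowerCont g X)
    (hC : ∀ x, e x ∈ C0 ↔ x ∈ C0) (hcomm : ∀ x, e (g x) = g (e x)) : LowerCont g (e ⁻¹' X) where
  closed := h.closed.preimage e.continuous
  preconn := e.isPreconnected_preimage.2 h.preconn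
  bot x hx := h.bot ((hC x).2 hx)
  back _ hx := h.back _ (by rw [← hcomm]; exact hx)

/-- The set of points whose forward orbit stays in `X`. -/
def stayingSet (g : Ann ≃ₜ Ann) (X : Set Ann) : Set Ann := {x | ∀ n, g^[n] x ∈ X}

namespace TwistLift

variable {T : TwistLift} {g : Ann ≃ₜ Ann}

lemma mem_C0_iff (hg : ∀ z, annProj (T.F z) = g (annProj z)) (x : Ann) :
    g x ∈ C0 ↔ x ∈ C0 := by
  obtain ⟨z, rfl⟩ := annProj_surjective x
  rw [← hg]
  have := T.bot z
  rw [Subtype.ext_iff, Subtype.ext_iff] at this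
  exact this

lemma symm_mem_C0_iff (hg : ∀ z, annProj (T.F z) = g (annProj z)) (x : Ann) :
    g.symm x ∈ C0 ↔ x ∈ C0 := by
  rw [← mem_C0_iff hg, g.apply_symm_apply]

lemma annProj_symm (hg : ∀ z, annProj (T.F z) = g (annProj z)) (z : StripA) :
    annProj (T.F.symm z) = g.symm (annProj z) := by
  apply g.injective
  rw [← hg, T.F.apply_symm_apply, g.apply_symm_apply]

lemma mirrorY_annProj (hg : ∀ z, annProj (T.F z) = g (annProj z)) (z : StripA) :
    annProj (T.mirrorY.F z) = (flipY.trans (g.symm.trans flipY)) (annProj z) := by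
  change annProj (reflY (T.F.symm (reflY z))) = flipY (g.symm (flipY (annProj z)))
  rw [annProj_reflY, annProj_symm hg, annProj_reflY]

lemma _root_.LowerCont.iterate (hg : ∀ z, annProj (T.F z) = g (annProj z)) {X : Set Ann}
    (hX : LowerCont g X) (n : ℕ) : LowerCont g (g^[n] ⁻¹' X) := by
  induction n with
  | zero => exact hX
  | succ n ih =>
    rw [Function.iterate_succ, preimage_comp]
    exact ih.preimage (mem_C0_iff hg) fun _ => rfl

lemma _root_.LowerCont.iterate_symm (hg : ∀ z, annProj (T.F z) = g (annProj z)) {X : Set Ann}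
    (hX : LowerCont g X) (n : ℕ) : LowerCont g (g.symm^[n] ⁻¹' X) := by
  induction n with
  | zero => exact hX
  | succ n ih =>
    rw [Function.iterate_succ, preimage_comp]
    exact ih.preimage (symm_mem_C0_iff hg) fun x => by simp

lemma _root_.LowerCont.antitone {X : Set Ann} (hX : LowerCont g X) :
    Antitone fun n => g^[n] ⁻¹' X := by
  refine antitone_nat_of_succ_le fun n x hx => hX.back _ ?_
  rwa [mem_preimage, Function.iterate_succ_apply'] at hx

lemma _root_.LowerCont.exists_subset {X : Set Ann} (hg : ∀ z, annProj (T.F z) = g (annProj z))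
    (hX : LowerCont g X) {U : Set Ann} (hU : IsOpen U) (h : stayingSet g X ⊆ U) :
    ∃ n, g^[n] ⁻¹' X ⊆ U :=
  exists_subset_nhds_of_compactSpace hX.antitone.directed_ge
    (fun n => (hX.iterate hg n).closed) fun _ hx =>
      hU.mem_nhds (h fun n => mem_iInter.1 hx n)

/-- A point whose forward orbit stays in a lower continuum missing part of `C₁` is in `C₀`. -/
lemma stayingSet_subset (hg : ∀ z, annProj (T.F z) = g (annProj z)) {X : Set Ann}
    (hX : LowerCont g X) (hX1 : X ∩ C1 = ∅) : stayingSet g X ⊆ C0 := by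
  have hC : C0 ⊆ stayingSet g X := fun x hx n => (hX.iterate hg n).bot hx
  have hK : LowerSide (annProj ⁻¹' stayingSet g X) := by
    refine ⟨?_, deckInv_preimage _, ?_⟩
    · refine IsClosed.preimage continuous_annProj ?_
      rw [show stayingSet g X = ⋂ n, g^[n] ⁻¹' X by ext; simp [stayingSet]]
      exact isClosed_iInter fun n => (hX.iterate hg n).closed
    · intro W hW hd hXW p hp
      obtain ⟨n, hn⟩ := hX.exists_subset hg (isOpenMap_annProj W hW) fun x hx => by
        obtain ⟨z, rfl⟩ := annProj_surjective x
        exact ⟨z, hXW hx, rfl⟩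
      refine (hX.iterate hg n).lowerSide.conn W hW hd (fun z hz => ?_) p (hp n)
      obtain ⟨w, hw, hwz⟩ := hn hz
      exact hd.of_annProj_eq hwz hw
  have hinv : ∀ z, T.F z ∈ annProj ⁻¹' stayingSet g X ↔ z ∈ annProj ⁻¹' stayingSet g X := by
    intro z
    rw [mem_preimage, hg]
    constructor
    · intro h n
      refine hX.back _ ?_
      rw [← Function.iterate_succ_apply' g, Function.iterate_succ_apply]
      exact h n
    · intro h n
      rw [← Function.iterate_succ_apply]
      exact h (n + 1)
  intro x hx
  by_contra hx0
  obtain ⟨z, rfl⟩ := annProj_surjective x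
  have := T.top_subset hK hinv
    (fun w hw => hC (show (w.2 : ℝ) = 0 by rw [hw]; rfl))
    ⟨z, hx, fun h => hx0 (show (z.2 : ℝ) = 0 by rw [h]; rfl)⟩ (0, 1) rfl
  have h1 : annProj (0, 1) ∈ X ∩ C1 := ⟨this 0, rfl⟩
  rw [hX1] at h1
  exact h1

lemma eventually_mem (hg : ∀ z, annProj (T.F z) = g (annProj z)) {X : Set Ann}
    (hX : LowerCont g X) (hX1 : X ∩ C1 = ∅) {U : Set Ann} (hU : IsOpen U) (h0 : C0 ⊆ U)
    {x : Ann} (hx : x ∈ X) : ∀ᶠ n in atTop, g.symm^[n] x ∈ U := by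
  obtain ⟨n, hn⟩ := hX.exists_subset hg hU ((stayingSet_subset hg hX hX1).trans h0)
  filter_upwards [eventually_ge_atTop n] with m hm
  refine hn (hX.antitone hm ?_)
  rw [mem_preimage, Function.LeftInverse.iterate g.apply_symm_apply m x]
  exact hx

/-- The order relation between points of a lower and of an upper continuum. -/
lemma exists_hasAng (hg : ∀ z, annProj (T.F z) = g (annProj z)) {X Y : Set Ann}
    (hX : LowerCont g X) (hY : LowerCont (flipY.trans (g.symm.trans flipY)) (flipY ⁻¹' Y))
    (hXY : ∀ x ∈ X, g x ∉ Y) {p q : StripA} (hp : annProj p ∈ X) (hq : annProj q ∈ Y) :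
    ∃ θ, HasAng (annProj ⁻¹' X) p q θ ∧ -(Real.pi / 2) < θ ∧ θ < 3 * Real.pi / 2 := by
  have hYf : ∀ y ∈ Y, g y ∈ Y := by
    intro y hy
    have := hY.back (flipY (g y)) (by
      change flipY (flipY (g.symm (flipY (flipY (g y))))) ∈ Y
      simpa only [flipY_flipY, g.symm_apply_apply] using hy)
    rwa [mem_preimage, flipY_flipY] at this
  have hYc : IsClosed Y := by
    have := hY.closed.preimage flipY.continuous
    rw [← preimage_comp] at this
    convert this using 1
    ext y
    simp [flipY_flipY]
  have hYp : IsPreconnected Y := (flipY.isPreconnected_preimage).1 hY.preconn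
  have hY1 : C1 ⊆ Y := by
    intro y hy
    have := hY.bot (flipY_mem_C0.2 hy)
    rwa [mem_preimage, flipY_flipY] at this
  have hgY : g.symm ⁻¹' (g ⁻¹' Y) = Y := by
    ext y
    simp
  have hXinv : ∀ z ∈ annProj ⁻¹' X, T.F.symm z ∈ annProj ⁻¹' X := by
    intro z hz
    refine hX.back _ ?_
    rw [annProj_symm hg, g.apply_symm_apply]
    exact hz
  have hqt : T.F.symm q ∈ TopComp (annProj ⁻¹' X) := by
    refine mem_topComp_of_isPreconnected (Y := g ⁻¹' Y) (g.isPreconnected_preimage.2 hYp)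
      (fun y hy => hYf y (hY1 hy)) hX.lowerSide.closed hX.lowerSide.deck
      (fun z hz hz' => hXY _ hz' hz) ?_
    rw [annProj_symm hg, mem_preimage, g.apply_symm_apply]
    exact hq
  obtain ⟨θ, hθ⟩ := HasAng.exists hp (by simpa using T.topComp_forward hXinv hqt)
  refine ⟨θ, hθ, ?_, T.angle_lt hX.lowerSide hXinv hp hqt hθ⟩
  have hXY' : ∀ z, annProj z ∈ X → z ∉ annProj ⁻¹' Y := fun z hz hz' =>
    hXY _ hz (hYf _ hz')
  have h2 := (hθ.dual hp hX.lowerSide.deck hX.lowerSide.conn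
    (hYc.preimage continuous_annProj).isOpen_compl (deckInv_preimage Y).compl hXY').reflY
  rw [compl_compl] at h2
  have hY' : LowerSide (reflY ⁻¹' (annProj ⁻¹' Y)) := hY.lowerSide
  have hpt : T.mirrorY.F.symm (reflY p) ∈ TopComp (reflY ⁻¹' (annProj ⁻¹' Y)) := by
    refine mem_topComp_of_isPreconnected (Y := flipY ⁻¹' (g.symm ⁻¹' X))
      ((flipY.isPreconnected_preimage).2 (g.symm.isPreconnected_preimage.2 hX.preconn))
      (fun y hy => hX.bot ((symm_mem_C0_iff hg _).2 (flipY_mem_C0.2 hy))) hY'.closed hY'.deck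
      (fun z hz hz' => hXY _ hz ?_) ?_
    · rw [g.apply_symm_apply]
      exact hz'
    · change g.symm (annProj (reflY (reflY (T.F (reflY (reflY p)))))) ∈ X
      rw [reflY_reflY, reflY_reflY, hg, g.symm_apply_apply]
      exact hp
  have h3 := T.mirrorY.angle_lt hY' (fun z hz => by
    change annProj (reflY (reflY (T.F (reflY z)))) ∈ Y
    rw [reflY_reflY, hg]
    exact hYf _ hz) (by rw [mem_preimage, reflY_reflY]; exact hq) hpt h2
  linarith

lemma fst_lt_fst (hg : ∀ z, annProj (T.F z) = g (annProj z)) {X Y : Set Ann}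
    (hX : LowerCont g X) (hY : LowerCont (flipY.trans (g.symm.trans flipY)) (flipY ⁻¹' Y))
    (hXY : ∀ x ∈ X, g (g x) ∉ Y) (hYf : ∀ y ∈ Y, g y ∈ Y) {p q : StripA}
    (hp : annProj p ∈ X) (hq : annProj q ∈ Y) (hpq : p.1 ≤ q.1) : (T.F p).1 < (T.F q).1 := by
  have hpi := Real.pi_pos
  have hX' : LowerCont g (g.symm ⁻¹' X) := hX.preimage (symm_mem_C0_iff hg) fun x => by simp
  have hp' : annProj (T.F p) ∈ g.symm ⁻¹' X := by
    rw [hg, mem_preimage, g.symm_apply_apply]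
    exact hp
  obtain ⟨θ, hθ, h1, h2⟩ := exists_hasAng hg hX hY
    (fun x hx h => hXY x hx (hYf _ h)) hp hq
  obtain ⟨θ', hθ', h1', -⟩ := exists_hasAng hg hX' hY
    (fun x hx h => hXY _ hx (by rwa [g.apply_symm_apply])) hp'
    (show annProj (T.F q) ∈ Y by rw [hg]; exact hYf _ hq)
  obtain ⟨θ'', hθ'', hstep⟩ := T.hasAng_step (K' := annProj ⁻¹' (g.symm ⁻¹' X)) (fun z hz => by
    rw [mem_preimage, hg, mem_preimage, g.symm_apply_apply] at hz
    exact hz) hθ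
  obtain rfl := hθ'.unique hp' hX'.lowerSide.deck hX'.lowerSide.conn hθ''
  have hle : θ ≤ Real.pi / 2 := by
    by_contra! hlt
    have hc : Real.cos θ < 0 := Real.cos_neg_of_pi_div_two_lt_of_lt hlt (by linarith)
    have hre := (re_im_of_coe_eq_arg hθ.coe_eq.2).1
    rw [dv_re] at hre
    have hn : 0 < ‖dv p q‖ := norm_pos_iff.2 (dv_ne_zero hθ.coe_eq.1)
    nlinarith [mul_neg_of_pos_of_neg hn hc]
  have hlt := hstep 0 (by simpa using hle)
  simp only [Int.cast_zero, zero_mul, add_zero] at hlt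
  have hc : 0 < Real.cos θ' := Real.cos_pos_of_mem_Ioo ⟨by linarith, hlt⟩
  have hre := (re_im_of_coe_eq_arg hθ'.coe_eq.2).1
  rw [dv_re] at hre
  have hn : 0 < ‖dv (T.F p) (T.F q)‖ := norm_pos_iff.2 (dv_ne_zero hθ'.coe_eq.1)
  nlinarith [mul_pos hn hc]

/-- The unstable set of a lower continuum is dense near `C₁`. -/
lemma C1_subset_closure (hg : ∀ z, annProj (T.F z) = g (annProj z)) {X : Set Ann}
    (hX : LowerCont g X) (hne : ∃ x ∈ X, x ∉ C0) : C1 ⊆ closure (⋃ n, g.symm^[n] ⁻¹' X) := by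
  set P := ⋃ n, g.symm^[n] ⁻¹' X with hP
  have h0P : C0 ⊆ P := fun x hx => mem_iUnion.2 ⟨0, hX.bot hx⟩
  have hXP : X ⊆ P := fun x hx => mem_iUnion.2 ⟨0, hx⟩
  have hconn : IsPreconnected P := by
    refine isPreconnected_iUnion ⟨annProj (0, 0), mem_iInter.2 fun n =>
      (hX.iterate_symm hg n).bot rfl⟩ fun n => (hX.iterate_symm hg n).preconn
  have hinv : g ⁻¹' P = P := by
    ext x
    rw [mem_preimage, hP, mem_iUnion, mem_iUnion]
    constructor
    · rintro ⟨n, hn⟩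
      exact ⟨n, (hX.iterate_symm hg n).back x hn⟩
    · rintro ⟨n, hn⟩
      refine ⟨n + 1, ?_⟩
      rw [mem_preimage, Function.iterate_succ_apply, g.symm_apply_apply]
      exact hn
  have hinv' : g ⁻¹' closure P = closure P := by rw [g.preimage_closure, hinv]
  have hK := lowerSide_preimage isClosed_closure hconn.closure (h0P.trans subset_closure)
  obtain ⟨x, hx, hx0⟩ := hne
  obtain ⟨z, rfl⟩ := annProj_surjective x
  intro y hy
  obtain ⟨c, rfl⟩ := annProj_surjective y
  refine T.top_subset hK (fun z => ?_)
    (fun w hw => subset_closure (h0P (show (w.2 : ℝ) = 0 by rw [hw]; rfl)))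
    ⟨z, subset_closure (hXP hx), fun h => hx0 (show (z.2 : ℝ) = 0 by rw [h]; rfl)⟩ c
    (Subtype.ext hy)
  rw [mem_preimage, hg, ← mem_preimage, hinv', mem_preimage]

lemma exists_iterate_mem (hg : ∀ z, annProj (T.F z) = g (annProj z)) {X Y : Set Ann}
    (hX : LowerCont g X) (hY : LowerCont (flipY.trans (g.symm.trans flipY)) (flipY ⁻¹' Y))
    (hYf : ∀ y ∈ Y, g y ∈ Y) (hXne : ∃ x ∈ X, x ∉ C0) (hYne : ∃ y ∈ Y, y ∉ C1) :
    ∃ n : ℕ, ∃ x ∈ X, g^[n] x ∈ Y := by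
  by_contra! hdis
  set P := ⋃ n, g.symm^[n] ⁻¹' X with hP
  have hd : ∀ n : ℕ, ∀ x ∈ g.symm^[n] ⁻¹' X, ∀ k, g^[k] x ∉ Y := by
    intro n x hx k
    have h := hdis (k + n) _ hx
    rwa [Function.iterate_add_apply, Function.LeftInverse.iterate g.apply_symm_apply n x] at h
  have hP' : ∀ x ∈ P, g.symm x ∈ P := by
    intro x hx
    obtain ⟨n, hn⟩ := mem_iUnion.1 hx
    exact mem_iUnion.2 ⟨n, (hX.iterate_symm hg n).back _ (by rwa [g.apply_symm_apply])⟩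
  have hY' : LowerCont (flipY.trans (g.symm.trans flipY)) (flipY ⁻¹' (g ⁻¹' Y)) := by
    have := hY.iterate_symm (mirrorY_annProj hg) 1
    convert this using 1
    ext x
    change _ ↔ flipY (flipY (g (flipY x))) ∈ Y
    rw [flipY_flipY]
    rfl
  have hord : ∀ p q, annProj p ∈ P → annProj q ∈ g ⁻¹' Y → p.1 ≤ q.1 →
      (T.F p).1 < (T.F q).1 := by
    intro p q hp hq hpq
    obtain ⟨n, hn⟩ := mem_iUnion.1 hp
    exact fst_lt_fst hg (hX.iterate_symm hg n) hY' (fun x hx => hd n x hx 3)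
      (fun y hy => hYf _ hy) hn hq hpq
  obtain ⟨y, hy, hy1⟩ := hYne
  obtain ⟨q, rfl⟩ := annProj_surjective y
  have hq1 : q.2 < 1 := lt_of_le_of_ne q.2.2.2 fun h => hy1 (show (q.2 : ℝ) = 1 by rw [h]; rfl)
  have hc : ((q.1, 1) : StripA) ∈ closure (annProj ⁻¹' P) := by
    rw [← isOpenMap_annProj.preimage_closure_eq_closure_preimage continuous_annProj]
    exact C1_subset_closure hg hX hXne (show ((1 : ↥(Icc (0:ℝ) 1)) : ℝ) = 1 from rfl)
  have hcont : Continuous fun z : StripA => (T.F z).1 := continuous_fst.comp T.F.continuous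
  have hcont' : Continuous fun z : StripA => (T.F.symm z).1 :=
    continuous_fst.comp T.F.symm.continuous
  have hsub : annProj ⁻¹' P ⊆
      {z | (T.F z).1 ≤ (T.F q).1} ∪ {z | (T.F.symm q).1 ≤ (T.F.symm z).1} := by
    intro p hp
    rcases le_total p.1 q.1 with hpq | hpq
    · exact Or.inl (hord p q hp (hYf _ hy) hpq).le
    · refine Or.inr ?_
      change (T.F.symm q).1 ≤ (T.F.symm p).1
      by_contra! hlt
      have := hord (T.F.symm p) (T.F.symm q) (by rw [annProj_symm hg]; exact hP' _ hp)
        (by rw [annProj_symm hg, mem_preimage, g.apply_symm_apply]; exact hy) hlt.le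
      rw [T.F.apply_symm_apply, T.F.apply_symm_apply] at this
      exact this.not_ge hpq
  rcases closure_minimal hsub ((isClosed_le hcont continuous_const).union
    (isClosed_le continuous_const hcont')) hc with h | h
  · exact (T.twist q (q.1, 1) rfl hq1).not_ge h
  · exact (T.itwist q (q.1, 1) rfl hq1).not_ge h

end TwistLift

lemma AnnulusHomeo.iter_add_natCast (h : AnnulusHomeo) (k : ℤ) (n : ℕ) (x : Ann) :
    h.iter k (h.iter (n : ℤ) x) = h.iter (k + n) x := by
  simp only [AnnulusHomeo.iter, zpow_add, Equiv.Perm.mul_apply]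

lemma AnnulusHomeo.iter_neg_natCast (h : AnnulusHomeo) (k : ℕ) :
    h.iter (-(k : ℤ)) = h.toFun.symm^[k] := by
  funext z
  rw [AnnulusHomeo.iter, zpow_neg, zpow_natCast, ← inv_pow, ← Equiv.Perm.iterate_eq_pow]
  rfl

lemma tendsto_infDist_of_eventually_mem {α : Type*} {l : Filter α} {u : α → Ann} {C : Set Ann}
    (h : ∀ U, IsOpen U → C ⊆ U → ∀ᶠ k in l, u k ∈ U) :
    Tendsto (fun k => Metric.infDist (u k) C) l (𝓝 0) := by
  rw [Metric.tendsto_nhds]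
  intro ε hε
  filter_upwards [h {x | Metric.infDist x C < ε}
    (isOpen_lt (Metric.continuous_infDist_pt C) continuous_const)
    fun x hx => by
      change Metric.infDist x C < ε
      rwa [Metric.infDist_zero_of_mem hx]] with k hk
  rw [Real.dist_0_eq_abs, abs_of_nonneg Metric.infDist_nonneg]
  exact hk

lemma flipY_conj_symm_iterate (g : Ann ≃ₜ Ann) (n : ℕ) (x : Ann) :
    (flipY.trans (g.symm.trans flipY)).symm^[n] (flipY x) = flipY (g^[n] x) := by
  have h : Function.Semiconj flipY g (flipY.trans (g.symm.trans flipY)).symm := by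
    intro x
    change flipY (g x) = flipY (g (flipY (flipY x)))
    rw [flipY_flipY]
  exact ((h.iterate_right n).eq x).symm

/-- For a non wandering positive twist map with no invariant transverse essential loop
except `C₀` and `C₁`: a backward invariant continuum strictly containing `C₀` (disjoint
from `C₁`) eventually meets a forward invariant continuum strictly containing `C₁`
(disjoint from `C₀`), and the intersection points go from `C₀` to `C₁`. -/
theorem statement10 (f : PositiveTwistMap) (hnw : NonWandering f.toAnnulusHomeo)
    (hNoLoop : NoInvariantTransverseLoop f.toAnnulusHomeo)
    (X₀ : Set Ann) (hX₀ : IsContinuum X₀) (hback : X₀ ⊆ f.toFun '' X₀)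
    (hC0 : C0 ⊂ X₀) (hX₀C1 : X₀ ∩ C1 = ∅)
    (X₁ : Set Ann) (hX₁ : IsContinuum X₁) (hfwd : f.toFun '' X₁ ⊆ X₁)
    (hC1 : C1 ⊂ X₁) (hX₁C0 : X₁ ∩ C0 = ∅) :
    ∃ n : ℕ, (f.toAnnulusHomeo.iter (n : ℤ) '' X₀ ∩ X₁).Nonempty ∧
      ∀ z ∈ f.toAnnulusHomeo.iter (n : ℤ) '' X₀ ∩ X₁,
        Tendsto (fun k : ℤ => Metric.infDist (f.toAnnulusHomeo.iter k z) C0) atBot (𝓝 0) ∧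
        Tendsto (fun k : ℤ => Metric.infDist (f.toAnnulusHomeo.iter k z) C1) atTop (𝓝 0) := by
  have hg : ∀ z, annProj ((f.twistLift hnw hNoLoop).F z) = f.toFun (annProj z) := f.lift_proj
  have hX : LowerCont f.toFun X₀ := by
    refine ⟨hX₀.2.1.isClosed, hX₀.2.2, hC0.1, fun x hx => ?_⟩
    obtain ⟨y, hy, hyx⟩ := hback hx
    rwa [← f.toFun.injective hyx]
  have hYf : ∀ y ∈ X₁, f.toFun y ∈ X₁ := fun y hy => hfwd ⟨y, hy, rfl⟩
  have hY : LowerCont (flipY.trans (f.toFun.symm.trans flipY)) (flipY ⁻¹' X₁) := by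
    refine ⟨hX₁.2.1.isClosed.preimage flipY.continuous, flipY.isPreconnected_preimage.2 hX₁.2.2,
      fun x hx => hC1.1 (flipY_mem_C1.2 hx), fun x hx => ?_⟩
    have := hYf _ hx
    change f.toFun (flipY (flipY (f.toFun.symm (flipY x)))) ∈ X₁ at this
    rwa [flipY_flipY, f.toFun.apply_symm_apply] at this
  have hY1 : flipY ⁻¹' X₁ ∩ C1 = ∅ := by
    refine eq_empty_of_forall_notMem fun x hx => ?_
    have : flipY x ∈ X₁ ∩ C0 := ⟨hx.1, flipY_mem_C0.2 hx.2⟩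
    rw [hX₁C0] at this
    exact this
  obtain ⟨n, x, hx, hxn⟩ := TwistLift.exists_iterate_mem hg hX hY hYf
    (exists_of_ssubset hC0) (exists_of_ssubset hC1)
  refine ⟨n, ⟨_, ⟨x, hx, rfl⟩, by rwa [AnnulusHomeo.iter_natCast]⟩, ?_⟩
  rintro _ ⟨⟨w, hw, rfl⟩, hwY⟩
  constructor
  · refine tendsto_infDist_of_eventually_mem fun U hU h0 => ?_
    have hev := TwistLift.eventually_mem hg hX hX₀C1 hU h0 hw
    obtain ⟨N, hN⟩ := eventually_atTop.1 hev
    filter_upwards [eventually_le_atBot (-((N : ℤ) + n))] with k hk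
    obtain ⟨m, hm⟩ := Int.eq_ofNat_of_zero_le (a := -(k + n)) (by omega)
    rw [AnnulusHomeo.iter_add_natCast, show k + (n : ℤ) = -(m : ℤ) by omega,
      AnnulusHomeo.iter_neg_natCast]
    exact hN m (by omega)
  · refine tendsto_infDist_of_eventually_mem fun U hU h1 => ?_
    have hev := TwistLift.eventually_mem (TwistLift.mirrorY_annProj hg) hY hY1
      (hU.preimage flipY.continuous) (fun x hx => h1 (flipY_mem_C1.2 hx))
      (x := flipY (f.toAnnulusHomeo.iter (n : ℤ) w)) (by
        rw [mem_preimage, flipY_flipY]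
        exact hwY)
    obtain ⟨N, hN⟩ := eventually_atTop.1 hev
    filter_upwards [eventually_ge_atTop (N : ℤ)] with k hk
    obtain ⟨m, rfl⟩ := Int.eq_ofNat_of_zero_le (a := k) (by omega)
    have := hN m (by omega)
    rw [flipY_conj_symm_iterate, mem_preimage, flipY_flipY] at this
    rw [AnnulusHomeo.iter_natCast f.toAnnulusHomeo m]
    exact this
end

section
/- Endow ℤ with the Khalimsky topology and ℤ/4ℤ with the topology whose open sets are ∅, {−1̇}, {1̇}, {−1̇,1̇}, {−1̇,0̇,1̇}, {1̇,2̇,−1̇}, and ℤ/4ℤ itself (where k̇ = k + 4ℤ). Then the natural projection Π : ℤ → ℤ/4ℤ, k ↦ k + 4ℤ, is a covering map. -/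
/-- The Khalimsky (digital line) topology on `ℤ`, generated by the sets `{2k+1}` and
`{2k-1, 2k, 2k+1}`, `k ∈ ℤ`. -/
def khalimskyTop : TopologicalSpace ℤ :=
  TopologicalSpace.generateFrom
    {S : Set ℤ | ∃ k : ℤ, S = {2 * k + 1} ∨ S = {2 * k - 1, 2 * k, 2 * k + 1}}

/-- The topology on `ℤ/4ℤ` whose open sets are `∅`, `{-1̇}`, `{1̇}`, `{-1̇,1̇}`,
`{-1̇,0̇,1̇}`, `{1̇,2̇,-1̇}` and `ℤ/4ℤ`. -/
def zmod4Top : TopologicalSpace (ZMod 4) :=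
  TopologicalSpace.generateFrom
    {({-1} : Set (ZMod 4)), {1}, {-1, 0, 1}, {1, 2, -1}}

open Topology

theorem isOpen_khalimskyTop_iff {S : Set ℤ} :
    IsOpen[khalimskyTop] S ↔ ∀ k : ℤ, 2 * k ∈ S → 2 * k - 1 ∈ S ∧ 2 * k + 1 ∈ S := by
  let := khalimskyTop
  constructor
  · intro h
    induction h with
    | basic s hs =>
      obtain ⟨j, rfl | rfl⟩ := hs <;> intro k hk <;>
        simp only [Set.mem_insert_iff, Set.mem_singleton_iff] at hk ⊢ <;> omega
    | univ => simp
    | inter s t _ _ hs ht =>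
      exact fun k hk => ⟨⟨(hs k hk.1).1, (ht k hk.2).1⟩, (hs k hk.1).2, (ht k hk.2).2⟩
    | sUnion C _ hC =>
      rintro k ⟨s, hs, hk⟩
      exact ⟨⟨s, hs, (hC s hs k hk).1⟩, s, hs, (hC s hs k hk).2⟩
  · intro h
    refine isOpen_iff_forall_mem_open.2 fun x hx => ?_
    obtain ⟨k, rfl | rfl⟩ := Int.even_or_odd' x
    · refine ⟨{2 * k - 1, 2 * k, 2 * k + 1}, ?_, .basic _ ⟨k, .inr rfl⟩, by simp⟩
      rintro y (rfl | rfl | rfl)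
      exacts [(h k hx).1, hx, (h k hx).2]
    · exact ⟨{2 * k + 1}, by simpa using hx, .basic _ ⟨k, .inl rfl⟩, rfl⟩

theorem isOpen_zmod4Top_iff {S : Set (ZMod 4)} :
    IsOpen[zmod4Top] S ↔ (0 ∈ S ∨ 2 ∈ S → -1 ∈ S ∧ 1 ∈ S) := by
  let := zmod4Top
  constructor
  · intro h
    induction h with
    | basic s hs => rcases hs with rfl | rfl | rfl | rfl <;> simp <;> decide
    | univ => simp
    | inter s t _ _ hs ht => simp only [Set.mem_inter_iff]; tauto
    | sUnion C _ hC =>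
      rintro (⟨s, hs, hk⟩ | ⟨s, hs, hk⟩)
      · exact ⟨⟨s, hs, (hC s hs (.inl hk)).1⟩, s, hs, (hC s hs (.inl hk)).2⟩
      · exact ⟨⟨s, hs, (hC s hs (.inr hk)).1⟩, s, hs, (hC s hs (.inr hk)).2⟩
  · intro h
    refine isOpen_iff_forall_mem_open.2 fun x hx => ?_
    have hx' : x = 0 ∨ x = 1 ∨ x = 2 ∨ x = -1 := by clear hx; revert x; decide
    rcases hx' with rfl | rfl | rfl | rfl
    · refine ⟨{-1, 0, 1}, ?_, .basic _ (by simp), by simp⟩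
      rintro y (rfl | rfl | rfl)
      exacts [(h (.inl hx)).1, hx, (h (.inl hx)).2]
    · exact ⟨{1}, by simpa using hx, .basic _ (by simp), rfl⟩
    · refine ⟨{1, 2, -1}, ?_, .basic _ (by simp), by simp⟩
      rintro y (rfl | rfl | rfl)
      exacts [(h (.inr hx)).2, hx, (h (.inr hx)).1]
    · exact ⟨{-1}, by simpa using hx, .basic _ (by simp), rfl⟩

theorem isOpen_zmod4Top_iff_preimage {S : Set (ZMod 4)} :
    IsOpen[zmod4Top] S ↔ IsOpen[khalimskyTop] ((fun k : ℤ => (k : ZMod 4)) ⁻¹' S) := by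
  rw [isOpen_zmod4Top_iff, isOpen_khalimskyTop_iff]
  simp only [Set.mem_preimage]
  push_cast
  constructor
  · intro h k
    generalize (k : ZMod 4) = a
    have ha : (2 * a = 0 ∧ 2 * a - 1 = -1 ∧ 2 * a + 1 = 1) ∨
        (2 * a = 2 ∧ 2 * a - 1 = 1 ∧ 2 * a + 1 = -1) := by
      revert a; decide
    rcases ha with ⟨h₀, h₁, h₂⟩ | ⟨h₀, h₁, h₂⟩ <;> rw [h₁, h₂, h₀] <;> tauto
  · intro h
    have h₀ := h 0
    have h₂ := h 1
    have e₁ : (2 : ZMod 4) - 1 = 1 := by decide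
    have e₂ : (2 : ZMod 4) + 1 = -1 := by decide
    simp only [Int.cast_zero, Int.cast_one, mul_zero, mul_one, zero_sub, zero_add, e₁, e₂]
      at h₀ h₂
    tauto

theorem isAddQuotientCoveringMap_khalimsky :
    @IsAddQuotientCoveringMap ℤ (ZMod 4) khalimskyTop zmod4Top (fun k : ℤ => (k : ZMod 4))
      (AddSubgroup.zmultiples (4 : ℤ)) _ _ := by
  let := khalimskyTop
  let := zmod4Top
  refine (isAddQuotientCoveringMap_iff ..).2 ⟨?_, ⟨?_⟩, ?_, ?_⟩
  · exact ⟨.of_isOpen_preimage_iff_isOpen fun _ => isOpen_zmod4Top_iff_preimage.symm,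
      ZMod.intCast_surjective⟩
  · rintro ⟨g, hg⟩
    obtain ⟨m, rfl⟩ := Int.mem_zmultiples_iff.1 hg
    refine continuous_def.2 fun S hS => isOpen_khalimskyTop_iff.2 fun k hk => ?_
    have := isOpen_khalimskyTop_iff.1 hS (2 * m + k)
    simp only [Set.mem_preimage, AddSubgroup.mk_vadd, vadd_eq_add] at hk ⊢
    ring_nf at this hk ⊢
    exact this hk
  · intro a b
    rw [ZMod.intCast_eq_intCast_iff_dvd_sub, ← Int.mem_zmultiples_iff, ← neg_mem_iff, neg_sub]
    constructor
    · exact fun h => ⟨⟨_, h⟩, by simp [AddSubgroup.mk_vadd]⟩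
    · rintro ⟨⟨g, hg⟩, rfl⟩
      simpa [AddSubgroup.mk_vadd] using hg
  · intro e
    refine ⟨Set.Icc (e - 1) (e + 1), ?_, ?_⟩
    · refine mem_nhds_iff.2 ⟨{x | x = e ∨ (Odd x ∧ e - 1 ≤ x ∧ x ≤ e + 1)}, ?_, ?_, .inl rfl⟩
      · rintro x (rfl | h)
        · simp
        · exact h.2
      · refine isOpen_khalimskyTop_iff.2 fun k hk => ?_
        simp only [Set.mem_ofPred_eq, Int.odd_iff] at hk ⊢
        omega
    · rintro ⟨g, hg⟩ ⟨_, ⟨y, hy, rfl⟩, hx⟩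
      obtain ⟨m, rfl⟩ := Int.mem_zmultiples_iff.1 hg
      simp only [AddSubgroup.mk_vadd, vadd_eq_add, Set.mem_Icc] at hx hy
      ext
      simp only [ZeroMemClass.coe_zero]
      omega

/-- The natural projection `Π : ℤ → ℤ/4ℤ`, `k ↦ k + 4ℤ`, is a covering map, where `ℤ`
carries the Khalimsky topology and `ℤ/4ℤ` the topology above. -/
theorem statement11 :
    @IsCoveringMap ℤ (ZMod 4) khalimskyTop zmod4Top (fun k : ℤ => (k : ZMod 4)) := by
  let := khalimskyTop
  let := zmod4Top
  exact isAddQuotientCoveringMap_khalimsky.isCoveringMap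
end

section
/- Endow ℤ with the Khalimsky topology. Every continuous function φ : E → ℤ defined on a connected topological space E satisfies the Intermediate Value Theorem: if a and b belong to the image of φ and a ≤ c ≤ b, then c belongs to the image of φ. -/
/-- A set of integers is open in the Khalimsky topology as soon as it contains both neighbours of
each of its even elements. -/
theorem khalimskyTop_isOpen_of_even {S : Set ℤ}
    (hS : ∀ k : ℤ, 2 * k ∈ S → 2 * k - 1 ∈ S ∧ 2 * k + 1 ∈ S) : @IsOpen ℤ khalimskyTop S := by
  have hbasic (T : Set ℤ) (hT : ∃ k : ℤ, T = {2 * k + 1} ∨ T = {2 * k - 1, 2 * k, 2 * k + 1}) :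
      @IsOpen ℤ khalimskyTop T := TopologicalSpace.isOpen_generateFrom_of_mem hT
  refine (@isOpen_iff_forall_mem_open ℤ khalimskyTop S).2 fun x hx => ?_
  rcases Int.even_or_odd' x with ⟨k, rfl | rfl⟩
  · refine ⟨{2 * k - 1, 2 * k, 2 * k + 1}, ?_, hbasic _ ⟨k, Or.inr rfl⟩, by simp⟩
    rintro y (rfl | rfl | rfl)
    exacts [(hS k hx).1, hx, (hS k hx).2]
  · exact ⟨{2 * k + 1}, Set.singleton_subset_iff.2 hx, hbasic _ ⟨k, Or.inl rfl⟩, rfl⟩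

/-- **Intermediate Value Theorem** for continuous integer-valued functions on a connected
space, where `ℤ` carries the Khalimsky topology. -/
theorem statement13 {E : Type*} [TopologicalSpace E] [ConnectedSpace E]
    (φ : E → ℤ) (hφ : @Continuous E ℤ _ khalimskyTop φ)
    (a b c : ℤ) (ha : a ∈ Set.range φ) (hb : b ∈ Set.range φ)
    (hac : a ≤ c) (hcb : c ≤ b) :
    c ∈ Set.range φ := by
  by_contra hc
  have hne : ∀ x, φ x ≠ c := fun x hx => hc ⟨x, hx⟩
  have hpre {S : Set ℤ} (hS : ∀ k : ℤ, 2 * k ∈ S → 2 * k - 1 ∈ S ∧ 2 * k + 1 ∈ S) :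
      IsOpen (φ ⁻¹' S) :=
    @Continuous.isOpen_preimage E ℤ _ khalimskyTop φ hφ S (khalimskyTop_isOpen_of_even hS)
  have hopen : IsOpen (φ ⁻¹' Set.Iio c) ∧ IsOpen (φ ⁻¹' Set.Ioi c) := by
    rcases Int.even_or_odd' c with ⟨m, hm | hm⟩
    · constructor <;> refine hpre fun k hk => ?_ <;>
        simp only [Set.mem_Iio, Set.mem_Ioi] at hk ⊢ <;> omega
    · have hlt : φ ⁻¹' Set.Iio c = φ ⁻¹' Set.Iic c := by
        ext x
        exact ⟨fun h : φ x < c => h.le, fun h => lt_of_le_of_ne h (hne x)⟩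
      have hgt : φ ⁻¹' Set.Ioi c = φ ⁻¹' Set.Ici c := by
        ext x
        exact ⟨fun h : c < φ x => h.le, fun h => lt_of_le_of_ne h (hne x).symm⟩
      rw [hlt, hgt]
      constructor <;> refine hpre fun k hk => ?_ <;>
        simp only [Set.mem_Iic, Set.mem_Ici] at hk ⊢ <;> omega
  obtain ⟨x, rfl⟩ := ha
  obtain ⟨y, rfl⟩ := hb
  obtain ⟨z, hz, hz'⟩ := nonempty_inter hopen.1 hopen.2
    (Set.eq_univ_of_forall fun z => lt_or_gt_of_ne (hne z))
    ⟨x, lt_of_le_of_ne hac (hne x)⟩ ⟨y, lt_of_le_of_ne hcb (hne y).symm⟩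
  exact lt_asymm (a := φ z) (b := c) hz hz'
end

section
/- Let f be a homeomorphism of the closed annulus A = 𝕋 × [0,1] isotopic to the identity, f̃ a lift of f to Ã = ℝ × [0,1], and X ⊆ A a nonempty well ordered f-invariant closed set. Then there exists a real number ρ such that for every z̃ ∈ π⁻¹(X) and every k ∈ ℤ, −1 < p̃₁(f̃ᵏ(z̃)) − p̃₁(z̃) − kρ < 1. -/
open Set Filter Topology MeasureTheory

/-- If the displacements of all iterates of a permutation, measured by a real-valued function `p`,
vary by less than `1`, then the permutation has a rotation number, with error less than `1`. -/
theorem exists_rotation_number_of_displacement_lt_one {α : Type*} [Nonempty α]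
    (φ : Equiv.Perm α) (p : α → ℝ)
    (h : ∀ (k : ℕ) (z w : α), p ((φ ^ k) z) - p z < p ((φ ^ k) w) - p w + 1) :
    ∃ ρ : ℝ, ∀ (z : α) (k : ℤ),
      -1 < p ((φ ^ k) z) - p z - k * ρ ∧ p ((φ ^ k) z) - p z - k * ρ < 1 := by
  have lower : ∀ (m : ℕ) (z u : α) (n : ℕ),
      n * (p ((φ ^ m) z) - p z - 1) ≤ p ((φ ^ (m * n)) u) - p u := by
    intro m z u n
    induction n with
    | zero => simp
    | succ n ih =>
      have := h m z ((φ ^ (m * n)) u)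
      rw [← Equiv.Perm.mul_apply, ← pow_add, add_comm m] at this
      rw [mul_add_one, Nat.cast_succ]
      linarith
  have upper : ∀ (m : ℕ) (z u : α) (n : ℕ),
      p ((φ ^ (m * n)) u) - p u ≤ n * (p ((φ ^ m) z) - p z + 1) := by
    intro m z u n
    induction n with
    | zero => simp
    | succ n ih =>
      have := h m ((φ ^ (m * n)) u) z
      rw [← Equiv.Perm.mul_apply, ← pow_add, add_comm m] at this
      rw [mul_add_one, Nat.cast_succ]
      linarith
  obtain ⟨ρ, hlo, hup⟩ : ∃ ρ : ℝ,
      (∀ (n : ℕ) (z : α), 0 < n → (p ((φ ^ n) z) - p z - 1) / n ≤ ρ) ∧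
      (∀ (n : ℕ) (z : α), 0 < n → ρ ≤ (p ((φ ^ n) z) - p z + 1) / n) := by
    have key : ∀ (m n : ℕ) (z w : α), 0 < m → 0 < n →
        (p ((φ ^ m) z) - p z - 1) / m ≤ (p ((φ ^ n) w) - p w + 1) / n := by
      intro m n z w hm hn
      rw [div_le_div_iff₀ (by positivity) (by positivity)]
      have h1 := lower m z z n
      have h2 := upper n w z m
      rw [mul_comm n m] at h2
      linarith
    let u : α := Classical.arbitrary α
    let L : Set ℝ := {r | ∃ (n : ℕ) (z : α), 0 < n ∧ r = (p ((φ ^ n) z) - p z - 1) / n}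
    refine ⟨sSup L, fun n z hn => le_csSup ?_ ⟨n, z, hn, rfl⟩, fun n z hn => csSup_le ?_ ?_⟩
    · refine ⟨(p ((φ ^ 1) u) - p u + 1) / (1 : ℕ), ?_⟩
      rintro r ⟨m, w, hm, rfl⟩
      exact key m 1 w u hm one_pos
    · exact ⟨_, 1, u, one_pos, rfl⟩
    · rintro r ⟨m, w, hm, rfl⟩
      exact key m n w z hm hn
  have weak : ∀ (n : ℕ) (z : α),
      p ((φ ^ n) z) - p z - 1 ≤ n * ρ ∧ n * ρ ≤ p ((φ ^ n) z) - p z + 1 := by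
    intro n z
    rcases Nat.eq_zero_or_pos n with rfl | hn
    · simp
    · have hn' : (0 : ℝ) < n := by exact_mod_cast hn
      have h1 := hlo n z hn
      have h2 := hup n z hn
      rw [div_le_iff₀ hn'] at h1
      rw [le_div_iff₀ hn'] at h2
      constructor <;> linarith
  have strict : ∀ (n : ℕ) (z : α),
      -1 < p ((φ ^ n) z) - p z - n * ρ ∧ p ((φ ^ n) z) - p z - n * ρ < 1 := by
    intro n z
    have h1 := weak n z
    have h2 := weak (n + n) z
    have h3 := h n z ((φ ^ n) z)
    have h4 := h n ((φ ^ n) z) z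
    rw [← Equiv.Perm.mul_apply, ← pow_add] at h3 h4
    rw [Nat.cast_add] at h2
    constructor <;> by_contra! hc <;> linarith
  refine ⟨ρ, fun z k => ?_⟩
  obtain ⟨n, rfl | rfl⟩ := k.eq_nat_or_neg
  · simpa using strict n z
  · have := strict n ((φ ^ (-(n : ℤ))) z)
    rw [← zpow_natCast, ← Equiv.Perm.mul_apply, ← zpow_add, add_neg_cancel, zpow_zero,
      Equiv.Perm.one_apply] at this
    rw [Int.cast_neg, Int.cast_natCast]
    constructor <;> linarith

theorem annProj_deckZ (m : ℤ) (z : StripA) : annProj (deckZ m z) = annProj z := by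
  simp only [annProj, deckZ, AddCircle.coe_add, Prod.mk.injEq, and_true, add_eq_left]
  rw [AddCircle.coe_eq_zero_iff]
  exact ⟨m, by simp⟩

theorem AnnulusHomeo.lift_deckZ (f : AnnulusHomeo) (m : ℤ) (z : StripA) :
    f.lift (deckZ m z) = deckZ m (f.lift z) := by
  have hsucc : ∀ (m : ℤ) (z : StripA), deckZ (m + 1) z = deckT (deckZ m z) := fun m z => by
    simp [deckZ, deckT, add_assoc]
  induction m with
  | zero => simp [deckZ]
  | succ n ih => rw [hsucc, hsucc, f.lift_deck, ih]
  | pred n ih =>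
    have hinj : Function.Injective deckT := fun a b hab => by
      simpa [deckT, Prod.ext_iff] using hab
    apply hinj
    rw [← f.lift_deck, ← hsucc, ← hsucc, sub_add_cancel, ih]

theorem AnnulusHomeo.lift_pow_deckZ (f : AnnulusHomeo) (k : ℕ) (m : ℤ) (z : StripA) :
    ((f.lift.toEquiv : Equiv.Perm StripA) ^ k) (deckZ m z) =
      deckZ m (((f.lift.toEquiv : Equiv.Perm StripA) ^ k) z) := by
  induction k with
  | zero => rfl
  | succ k ih =>
    rw [pow_succ', Equiv.Perm.mul_apply, Equiv.Perm.mul_apply, ih]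
    exact f.lift_deckZ m _

namespace IsWellOrdered

variable {f : AnnulusHomeo} {X : Set Ann}

theorem annProj_lift_mem_iff (hwo : IsWellOrdered f X) (z : StripA) :
    annProj (f.lift z) ∈ X ↔ annProj z ∈ X := by
  rw [f.lift_proj]
  nth_rw 1 [← hwo.2.1]
  exact f.toFun.injective.mem_set_image

theorem lift_pow_fst_lt (hwo : IsWellOrdered f X) (k : ℕ) {z w : StripA}
    (hz : annProj z ∈ X) (hw : annProj w ∈ X) (h : z.1 < w.1) :
    (((f.lift.toEquiv : Equiv.Perm StripA) ^ k) z).1 <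
      (((f.lift.toEquiv : Equiv.Perm StripA) ^ k) w).1 := by
  induction k generalizing z w with
  | zero => exact h
  | succ k ih =>
    rw [pow_succ, Equiv.Perm.mul_apply, Equiv.Perm.mul_apply]
    exact ih ((hwo.annProj_lift_mem_iff z).2 hz) ((hwo.annProj_lift_mem_iff w).2 hw)
      (hwo.2.2.2 z w hz hw h)

theorem displacement_lt (hwo : IsWellOrdered f X) (k : ℕ) {z w : StripA}
    (hz : annProj z ∈ X) (hw : annProj w ∈ X) :
    (((f.lift.toEquiv : Equiv.Perm StripA) ^ k) z).1 - z.1 <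
      (((f.lift.toEquiv : Equiv.Perm StripA) ^ k) w).1 - w.1 + 1 := by
  have hm1 := Int.floor_le (z.1 - w.1)
  have hm2 := Int.lt_floor_add_one (z.1 - w.1)
  set m := ⌊z.1 - w.1⌋
  have hlt := hwo.lift_pow_fst_lt k (w := deckZ (m + 1) w) hz
    (by rwa [annProj_deckZ]) (by simp only [deckZ]; push_cast; linarith)
  rw [f.lift_pow_deckZ] at hlt
  simp only [deckZ] at hlt
  rw [Int.cast_add, Int.cast_one] at hlt
  linarith

end IsWellOrdered

/-- Every nonempty well ordered invariant closed set has a rotation number. -/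
theorem statement14 (f : AnnulusHomeo) (X : Set Ann) (hne : X.Nonempty)
    (hwo : IsWellOrdered f X) :
    ∃ ρ : ℝ, ∀ z : StripA, annProj z ∈ X → ∀ k : ℤ,
      -1 < (f.liftIter k z).1 - z.1 - (k : ℝ) * ρ ∧
        (f.liftIter k z).1 - z.1 - (k : ℝ) * ρ < 1 := by
  obtain ⟨⟨x, y⟩, hx⟩ := hne
  obtain ⟨t, rfl⟩ := QuotientAddGroup.mk_surjective x
  have : Nonempty {z : StripA // annProj z ∈ X} := ⟨⟨(t, y), hx⟩⟩
  let φ : Equiv.Perm {z : StripA // annProj z ∈ X} :=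
    Equiv.Perm.subtypePerm f.lift.toEquiv hwo.annProj_lift_mem_iff
  obtain ⟨ρ, hρ⟩ := exists_rotation_number_of_displacement_lt_one φ (fun z => z.1.1) <| by
    rintro k ⟨z, hz⟩ ⟨w, hw⟩
    simpa [φ, Equiv.Perm.subtypePerm_pow] using hwo.displacement_lt k hz hw
  refine ⟨ρ, fun z hz k => ?_⟩
  simpa [φ, Equiv.Perm.subtypePerm_zpow, AnnulusHomeo.liftIter] using hρ ⟨z, hz⟩ k
end
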